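/- arXiv:1503.07272 — 3 statements merged into one kernel-verified Lean document; each statement's English description precedes it below -/
import Mathlib

section
/- Compactness for bounded first-order energies: let eps_k -> 0+ and let v_k in H^1_eta satisfy sup_k (1/eps_k) G_{eps_k}(v_k) < infinity. Then there exist a subsequence (not relabeled) and a function v in the class C such that v_k -> v in L^1_eta. -/
open MeasureTheory Set Filter Topology Asymptotics
open scoped ENNReal Classical

noncomputable section

/-- The double-well potential hypotheses \eqref{W_Smooth}-\eqref{WGurtin_Assumption}:
`W ≥ 0` is `C²` away from its two zeros `a < b`, the second derivative behaves like
`l * |s - a|^(q-1)` (resp. `l * |s - b|^(q-1)`) near the wells, `W'` has exactly the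
three zeros `a < c < b` with `W'' (c) < 0`, and `|W'|` stays bounded away from `0`
at infinity. -/
structure DoubleWell (W : ℝ → ℝ) (a b c q l : ℝ) : Prop where
  lt_ab : a < b
  lt_ac : a < c
  lt_cb : c < b
  nonneg : ∀ s, 0 ≤ W s
  smooth : ContDiffOn ℝ 2 W (({a, b} : Set ℝ)ᶜ)
  zeros : ∀ s, W s = 0 ↔ s = a ∨ s = b
  q_mem : q ∈ Set.Ioc (0 : ℝ) 1
  l_pos : 0 < l
  lim_a : Filter.Tendsto (fun s => deriv (deriv W) s / |s - a| ^ (q - 1)) (𝓝[≠] a) (𝓝 l)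
  lim_b : Filter.Tendsto (fun s => deriv (deriv W) s / |s - b| ^ (q - 1)) (𝓝[≠] b) (𝓝 l)
  deriv_zeros : ∀ s, deriv W s = 0 ↔ s = a ∨ s = c ∨ s = b
  concave_c : deriv (deriv W) c < 0
  coercive : ∃ L > 0, ∃ R : ℝ, ∀ s : ℝ, R ≤ |s| → L ≤ |deriv W s|

/-- The hypotheses \eqref{etaSmooth}-\eqref{etaPrimeRatio} on the weight `η` on
`I = (-T,T)`: positivity, `C^{1,β}` regularity, power-like behaviour
`(t+T)^(n₁-1)` resp. `(T-t)^(n₂-1)` at the two endpoints, and the bound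
`|η'| ≤ d₅ η / min{T-t, t+T}`. -/
structure GoodWeight (T : ℝ) (η : ℝ → ℝ) (β : ℝ) (n₁ n₂ : ℕ)
    (d₁ d₂ d₃ d₄ d₅ tstar : ℝ) : Prop where
  pos : ∀ t ∈ Set.Ioo (-T) T, 0 < η t
  integrable : MeasureTheory.IntegrableOn η (Set.Ioo (-T) T)
  beta_mem : β ∈ Set.Ioc (0 : ℝ) 1
  smooth : ContDiffOn ℝ 1 η (Set.Ioo (-T) T)
  holder : ∀ K : Set ℝ, K ⊆ Set.Ioo (-T) T → IsCompact K →
    ∃ C : ℝ, ∀ x ∈ K, ∀ y ∈ K, |deriv η x - deriv η y| ≤ C * |x - y| ^ β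
  n₁_pos : 1 ≤ n₁
  n₂_pos : 1 ≤ n₂
  d₁_pos : 0 < d₁
  d₂_pos : 0 < d₂
  d₃_pos : 0 < d₃
  d₄_pos : 0 < d₄
  d₅_pos : 0 < d₅
  tstar_mem : tstar ∈ Set.Ioo (0 : ℝ) T
  tail₁ : ∀ t ∈ Set.Ioc (-T) (-T + tstar),
    d₁ * (t + T) ^ (n₁ - 1) ≤ η t ∧ η t ≤ d₂ * (t + T) ^ (n₁ - 1)
  tail₂ : ∀ t ∈ Set.Ico (T - tstar) T,
    d₃ * (T - t) ^ (n₂ - 1) ≤ η t ∧ η t ≤ d₄ * (T - t) ^ (n₂ - 1)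
  deriv_bound : ∀ t ∈ Set.Ioo (-T) T, |deriv η t| ≤ d₅ * η t / min (T - t) (t + T)

/-- The heteroclinic profile: solution of `z' = √(W ∘ z)`, `z 0 = c`, `z ∈ [a,b]`. -/
structure CauchyProfile (W : ℝ → ℝ) (a b c : ℝ) (z : ℝ → ℝ) : Prop where
  ode : ∀ t, HasDerivAt z (Real.sqrt (W (z t))) t
  init : z 0 = c
  range : ∀ t, z t ∈ Set.Icc a b

/-- The weighted `L¹` distance on `(-T,T)`. -/
def dist1 (T : ℝ) (η v w : ℝ → ℝ) : ℝ :=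
  ∫ t in Set.Ioo (-T) T, |v t - w t| * η t

/-- Membership in the weighted space `H¹_η`. -/
def MemH1 (T : ℝ) (η v : ℝ → ℝ) : Prop :=
  (∀ t ∈ Set.Ioo (-T) T, DifferentiableAt ℝ v t) ∧
  MeasureTheory.IntegrableOn (fun t => ((v t) ^ 2 + (deriv v t) ^ 2) * η t) (Set.Ioo (-T) T)

/-- Membership in the weighted space `L¹_η`. -/
def MemL1 (T : ℝ) (η v : ℝ → ℝ) : Prop :=
  MeasureTheory.IntegrableOn (fun t => |v t| * η t) (Set.Ioo (-T) T)

/-- The mass constraint `∫_I v η dt = m`. -/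
def massEq (T : ℝ) (η : ℝ → ℝ) (m : ℝ) (v : ℝ → ℝ) : Prop :=
  (∫ t in Set.Ioo (-T) T, v t * η t) = m

/-- The weighted Cahn–Hilliard energy `∫_I (W(v) + ε² v'²) η dt` (real-valued). -/
def energy (T : ℝ) (W η : ℝ → ℝ) (ε : ℝ) (v : ℝ → ℝ) : ℝ :=
  ∫ t in Set.Ioo (-T) T, (W (v t) + ε ^ 2 * (deriv v t) ^ 2) * η t

/-- The rescaled energy `G_ε^{(1)}(v) = ∫_I (W(v)/ε + ε v'²) η dt` (real-valued). -/
def energy1 (T : ℝ) (W η : ℝ → ℝ) (ε : ℝ) (v : ℝ → ℝ) : ℝ :=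
  ∫ t in Set.Ioo (-T) T, (W (v t) / ε + ε * (deriv v t) ^ 2) * η t

/-- The weighted energy as an extended-real-valued integral. -/
def ennEnergy (T : ℝ) (W η : ℝ → ℝ) (ε : ℝ) (v : ℝ → ℝ) : ℝ≥0∞ :=
  ∫⁻ t in Set.Ioo (-T) T, ENNReal.ofReal ((W (v t) + ε ^ 2 * (deriv v t) ^ 2) * η t)

/-- The functional `G_ε` on `L¹_η` : the energy if `v ∈ H¹_η` satisfies the
mass constraint, `+∞` otherwise. -/
def GepsE (T : ℝ) (W η : ℝ → ℝ) (m ε : ℝ) (v : ℝ → ℝ) : ℝ≥0∞ :=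
  if MemH1 T η v ∧ massEq T η m v then ennEnergy T W η ε v else ⊤

/-- The functional `G_ε^{(1)} = G_ε / ε` on `L¹_η`. -/
def Geps1E (T : ℝ) (W η : ℝ → ℝ) (m ε : ℝ) (v : ℝ → ℝ) : ℝ≥0∞ :=
  if MemH1 T η v ∧ massEq T η m v then
    ∫⁻ t in Set.Ioo (-T) T, ENNReal.ofReal ((W (v t) / ε + ε * (deriv v t) ^ 2) * η t)
  else ⊤

/-- The zeroth order Γ-limit `G⁽⁰⁾`. -/
def G0E (T : ℝ) (W η : ℝ → ℝ) (m : ℝ) (v : ℝ → ℝ) : ℝ≥0∞ :=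
  if MemL1 T η v ∧ massEq T η m v then
    ∫⁻ t in Set.Ioo (-T) T, ENNReal.ofReal (W (v t) * η t)
  else ⊤

/-- The set of values whose supremum is the weighted total variation
`∫_I η d|Dv| = sup { ∫_I v φ' dt : φ ∈ C¹_c(I), |φ| ≤ η }`. -/
def wTVvals (T : ℝ) (η v : ℝ → ℝ) : Set ℝ :=
  { r | ∃ φ : ℝ → ℝ, ContDiff ℝ 1 φ ∧ HasCompactSupport φ ∧
      tsupport φ ⊆ Set.Ioo (-T) T ∧ (∀ t ∈ Set.Ioo (-T) T, |φ t| ≤ η t) ∧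
      r = ∫ t in Set.Ioo (-T) T, v t * deriv φ t }

/-- The weighted total variation `∫_I η d|Dv|`. -/
def wTV (T : ℝ) (η v : ℝ → ℝ) : ℝ := sSup (wTVvals T η v)

/-- The class `𝒞` of `BV_η` functions with values in `{a,b}` satisfying the mass
constraint. -/
def memC (T : ℝ) (η : ℝ → ℝ) (a b m : ℝ) (v : ℝ → ℝ) : Prop :=
  (∀ᵐ t ∂(MeasureTheory.volume.restrict (Set.Ioo (-T) T)), v t = a ∨ v t = b) ∧
  BddAbove (wTVvals T η v) ∧ massEq T η m v

/-- The single-interface step function `sgn_{a,b}(· - t₀)`. -/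
def stepAB (a b t₀ : ℝ) : ℝ → ℝ := fun t => if t ≤ t₀ then a else b

/-- Admissibility for the localized functional `J_ε`: `H¹_η` membership, mass
constraint, and distance at most `δ` from `v₀` in `L¹_η`. -/
def Adm (T : ℝ) (η : ℝ → ℝ) (m δ : ℝ) (v₀ v : ℝ → ℝ) : Prop :=
  MemH1 T η v ∧ massEq T η m v ∧ dist1 T η v v₀ ≤ δ

/-- `v` is a global minimizer of the localized functional `J_ε`. -/
def IsJMin (T : ℝ) (W η : ℝ → ℝ) (m δ ε : ℝ) (v₀ v : ℝ → ℝ) : Prop :=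
  Adm T η m δ v₀ v ∧
  ∀ w, Adm T η m δ v₀ w → ennEnergy T W η ε v ≤ ennEnergy T W η ε w

end

lemma helly_aux (P u : ℕ → ℝ → ℝ) (C : ℝ) (hmono : ∀ k, Monotone (P k))
    (hP : ∀ k t, P k t ∈ Icc 0 C) (hu : ∀ k t, u k t ∈ Icc 0 C) (I : Set ℝ)
    (hloc : ∀ t ∈ I, ∃ c > 0, ∃ δ > 0, ∀ k, ∀ x ∈ Ioo (t - δ) (t + δ), ∀ y ∈ Ioo (t - δ) (t + δ),
      x ≤ y → |u k y - u k x| ≤ c * (P k y - P k x)) :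
    ∃ φ : ℕ → ℕ, StrictMono φ ∧ ∃ D : Set ℝ, D.Countable ∧
      ∀ t ∈ I, t ∉ D → ∃ l, Tendsto (fun k => u (φ k) t) atTop (𝓝 l) := by
  have hcomp : IsCompact (Set.pi univ (fun _ : ℚ => (Icc (0:ℝ) C ×ˢ Icc (0:ℝ) C))) :=
    isCompact_univ_pi (fun _ => isCompact_Icc.prod isCompact_Icc)
  obtain ⟨Lm, -, φ, hφ, hlim⟩ := hcomp.tendsto_subseq
    (x := fun k (q : ℚ) => (P k q, u k q)) (fun k q _ => ⟨hP k q, hu k q⟩)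
  rw [tendsto_pi_nhds] at hlim
  have hlP : ∀ q : ℚ, Tendsto (fun k => P (φ k) q) atTop (𝓝 (Lm q).1) :=
    fun q => (continuous_fst.tendsto _).comp (hlim q)
  have hlu : ∀ q : ℚ, Tendsto (fun k => u (φ k) q) atTop (𝓝 (Lm q).2) :=
    fun q => (continuous_snd.tendsto _).comp (hlim q)
  set F : ℝ → ℝ := fun t => limsup (fun k => P (φ k) t) atTop with hF
  have hFm : Monotone F := by
    intro x y hxy
    apply limsup_le_limsup
    · exact Eventually.of_forall (fun k => hmono _ hxy)
    · exact IsBoundedUnder.isCoboundedUnder_le ⟨0, by simpa using ⟨0, fun k _ => (hP (φ k) x).1⟩⟩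
    · exact ⟨C, by simpa using ⟨0, fun k _ => (hP (φ k) y).2⟩⟩
  have hFq : ∀ q : ℚ, F q = (Lm q).1 := fun q => (hlP q).limsup_eq
  refine ⟨φ, hφ, {t | ¬ ContinuousAt F t}, hFm.countable_not_continuousAt, ?_⟩
  intro t ht htD
  simp only [mem_ofPred_eq, not_not] at htD
  obtain ⟨c, hc, δ, hδ, hl⟩ := hloc t ht
  apply cauchySeq_tendsto_of_complete
  rw [Metric.cauchySeq_iff']
  intro e he
  rw [Metric.continuousAt_iff] at htD
  obtain ⟨δ', hδ', hF'⟩ := htD (e / (8 * c)) (by positivity)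
  obtain ⟨q1, hq1, hq1t⟩ := exists_rat_btwn (show t - min δ δ' < t by
    have := lt_min hδ hδ'; linarith)
  obtain ⟨q2, hq2t, hq2⟩ := exists_rat_btwn (show t < t + min δ δ' by
    have := lt_min hδ hδ'; linarith)
  have m1 := min_le_left δ δ'
  have m2 := min_le_right δ δ'
  have h1 := hF' (x := q1) (by rw [Real.dist_eq, abs_lt]; constructor <;> linarith)
  have h2 := hF' (x := q2) (by rw [Real.dist_eq, abs_lt]; constructor <;> linarith)
  rw [Real.dist_eq, abs_lt] at h1 h2
  have hd : (Lm q2).1 - (Lm q1).1 < e / (4 * c) := by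
    rw [← hFq, ← hFq]
    have : e / (4 * c) = e / (8 * c) + e / (8 * c) := by field_simp; norm_num
    linarith [h1.1, h2.2]
  have ev1 : ∀ᶠ k in atTop, P (φ k) q2 - P (φ k) q1 < e / (4 * c) :=
    ((hlP q2).sub (hlP q1)).eventually_lt_const hd
  have ev2 := (Metric.tendsto_nhds.1 (hlu q1)) (e / 8) (by positivity)
  obtain ⟨N, hN⟩ := eventually_atTop.1 (ev1.and ev2)
  have key : ∀ n ≥ N, |u (φ n) t - u (φ n) q1| < e / 4 := by
    intro n hn
    have a1 := hl (φ n) q1 ⟨by linarith, by linarith⟩ t ⟨by linarith, by linarith⟩ hq1t.le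
    have a2 : P (φ n) t ≤ P (φ n) q2 := hmono _ hq2t.le
    have a3 := (hN n hn).1
    calc _ ≤ c * (P (φ n) t - P (φ n) q1) := a1
      _ ≤ c * (P (φ n) q2 - P (φ n) q1) := by gcongr
      _ < c * (e / (4 * c)) := by gcongr
      _ = e / 4 := by field_simp
  refine ⟨N, fun n hn => ?_⟩
  have b1 := abs_lt.1 (key n hn)
  have b2 := abs_lt.1 (key N le_rfl)
  have b3 := (hN n hn).2
  have b4 := (hN N le_rfl).2
  rw [Real.dist_eq] at b3 b4 ⊢
  rw [abs_lt] at b3 b4 ⊢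
  constructor <;> linarith [b1.1, b1.2, b2.1, b2.2, b3.1, b3.2, b4.1, b4.2]

lemma W_meas {W : ℝ → ℝ} {a b c q l : ℝ} (hW : DoubleWell W a b c q l) : Measurable W := by
  have hc : ContinuousOn W ({a, b} : Set ℝ)ᶜ := hW.smooth.continuousOn
  apply measurable_of_measurable_on_compl_finite ({a, b} : Set ℝ) (by simp)
  exact (continuousOn_iff_continuous_domRestrict.1 hc).measurable

lemma W_contAt {W : ℝ → ℝ} {a b c q l : ℝ} (hW : DoubleWell W a b c q l) (s : ℝ)
    (h : s ≠ a ∧ s ≠ b) : ContinuousAt W s := by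
  apply hW.smooth.continuousOn.continuousAt
  exact (((finite_singleton b).insert a).isClosed.isOpen_compl).mem_nhds (by simp [h])

lemma W_diffAt {W : ℝ → ℝ} {a b c q l : ℝ} (hW : DoubleWell W a b c q l) (s : ℝ)
    (h : s ≠ a ∧ s ≠ b) : DifferentiableAt ℝ W s := by
  apply (hW.smooth.differentiableOn (by norm_num)).differentiableAt
  exact (((finite_singleton b).insert a).isClosed.isOpen_compl).mem_nhds (by simp [h])

lemma W_coer {W : ℝ → ℝ} {a b c q l : ℝ} (hW : DoubleWell W a b c q l) :
    ∃ K C : ℝ, 0 ≤ K ∧ 0 ≤ C ∧ ∀ s, |s| ≤ K + C * W s := by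
  obtain ⟨L, hL, R, hR⟩ := hW.coercive
  set Q := max |R| (max |a| |b|) + 1 with hQ
  have q1 : |R| < Q := by have := le_max_left |R| (max |a| |b|); linarith
  have q2 : |a| < Q := by
    have := (le_max_left |a| |b|).trans (le_max_right |R| (max |a| |b|)); linarith
  have q3 : |b| < Q := by
    have := (le_max_right |a| |b|).trans (le_max_right |R| (max |a| |b|)); linarith
  have hne : ∀ s, Q ≤ |s| → s ≠ a ∧ s ≠ b := by
    intro s hs
    constructor <;> rintro rfl <;> linarith
  have hQ0 : 0 < Q := lt_of_le_of_lt (abs_nonneg _) q1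
  have mvt : ∀ x y : ℝ, x < y → (∀ z ∈ Icc x y, Q ≤ |z|) → L * (y - x) ≤ W x + W y := by
    intro x y hxy hz
    obtain ⟨z, hz1, hz2⟩ := exists_deriv_eq_slope W hxy
      (fun z h => (W_contAt hW z (hne z (hz z h))).continuousWithinAt)
      (fun z h => (W_diffAt hW z (hne z (hz z (Ioo_subset_Icc_self h)))).differentiableWithinAt)
    have h1 := hR z ((le_abs_self R).trans (q1.le.trans (hz z (Ioo_subset_Icc_self hz1))))
    have hyx : 0 < y - x := by linarith
    rw [hz2, abs_div, abs_of_pos hyx, le_div_iff₀ hyx] at h1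
    have h2 : |W y - W x| ≤ W x + W y := by
      rw [abs_le]; constructor <;> linarith [hW.nonneg x, hW.nonneg y]
    linarith
  refine ⟨Q + (W Q + W (-Q)) / L, 1 / L, ?_, by positivity, ?_⟩
  · have := hW.nonneg Q; have := hW.nonneg (-Q); positivity
  intro s
  have w1 := hW.nonneg Q
  have w2 := hW.nonneg (-Q)
  have w3 := hW.nonneg s
  have : (|s| - Q) * L ≤ W Q + W (-Q) + W s := by
    rcases le_or_gt |s| Q with h | h
    · nlinarith
    · rcases lt_abs.1 h with h | h
      · have := mvt Q s h (fun z hz => hz.1.trans (le_abs_self z))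
        rw [abs_of_pos (by linarith)]; linarith
      · have := mvt s (-Q) (by linarith) (fun z hz => by
          have := neg_le_abs z; linarith [hz.2])
        rw [abs_of_neg (by linarith)]; linarith
  rw [← le_div_iff₀ hL] at this
  have e : (W Q + W (-Q) + W s) / L = (W Q + W (-Q)) / L + 1 / L * W s := by ring
  linarith

lemma Phi_exists {W : ℝ → ℝ} {a b c q l : ℝ} (hW : DoubleWell W a b c q l) :
    ∃ (Φ : ℝ → ℝ) (κ : ℝ), 0 < κ ∧ ContDiff ℝ 1 Φ ∧ (∀ s, Φ s ∈ Icc 0 κ) ∧ Φ a = 0 ∧ Φ b = κ ∧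
      ∀ s, (deriv Φ s) ^ 2 ≤ W s := by
  obtain ⟨p, hap, hpc⟩ := exists_between hW.lt_ac
  obtain ⟨r, hcr, hrb⟩ := exists_between hW.lt_cb
  have hpr : p < r := hpc.trans hcr
  have hpr' : 0 < r - p := by linarith
  have hne : ∀ s ∈ Icc p r, s ≠ a ∧ s ≠ b := by
    intro s hs
    constructor <;> rintro rfl <;> linarith [hs.1, hs.2]
  obtain ⟨s0, hs0, hmin⟩ := isCompact_Icc.exists_isMinOn (nonempty_Icc.2 hpr.le)
    (f := W) (fun s hs => (W_contAt hW s (hne s hs)).continuousWithinAt)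
  have hw0 : 0 < W s0 := by
    refine lt_of_le_of_ne (hW.nonneg _) fun h => ?_
    rcases (hW.zeros s0).1 h.symm with h | h
    · exact (hne s0 hs0).1 h
    · exact (hne s0 hs0).2 h
  set Ψ : ℝ → ℝ := fun s => Real.smoothTransition ((s - p) / (r - p)) with hΨ
  have hΨc : ContDiff ℝ 1 Ψ := by
    apply Real.smoothTransition.contDiff.comp
    fun_prop
  have hΨd : Continuous (deriv Ψ) := hΨc.continuous_deriv le_rfl
  obtain ⟨B, hB⟩ := isCompact_Icc.exists_bound_of_continuousOn (s := Icc p r) hΨd.continuousOn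
  have hB0 : 0 ≤ B := (norm_nonneg _).trans (hB p ⟨le_rfl, hpr.le⟩)
  have hlow : ∀ s, s ≤ p → Ψ s = 0 := fun s hs =>
    Real.smoothTransition.zero_of_nonpos (div_nonpos_of_nonpos_of_nonneg (by linarith) hpr'.le)
  have hhigh : ∀ s, r ≤ s → Ψ s = 1 := fun s hs =>
    Real.smoothTransition.one_of_one_le (by rw [le_div_iff₀ hpr']; linarith)
  set κ := Real.sqrt (W s0) / (B + 1) with hκ
  have hκ0 : 0 < κ := by have := Real.sqrt_pos.2 hw0; positivity
  have hκB : κ * B ≤ Real.sqrt (W s0) := by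
    rw [hκ, div_mul_eq_mul_div, div_le_iff₀ (by positivity)]
    nlinarith [Real.sqrt_nonneg (W s0)]
  refine ⟨fun s => κ * Ψ s, κ, hκ0, contDiff_const.mul hΨc, ?_, ?_, ?_, ?_⟩
  · intro s
    have h1 := Real.smoothTransition.nonneg ((s - p) / (r - p))
    have h2 := Real.smoothTransition.le_one ((s - p) / (r - p))
    exact ⟨by positivity, by simpa using mul_le_mul_of_nonneg_left h2 hκ0.le⟩
  · simp [hlow a hap.le]
  · simp [hhigh b hrb.le]
  · intro s
    have hd : deriv (fun s => κ * Ψ s) s = κ * deriv Ψ s :=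
      deriv_const_mul _ ((hΨc.differentiable (by norm_num)) s)
    rw [hd]
    by_cases hs : s ∈ Icc p r
    · have h1 : |deriv Ψ s| ≤ B := hB s hs
      have h2 : |κ * deriv Ψ s| ≤ Real.sqrt (W s0) := by
        rw [abs_mul, abs_of_pos hκ0]
        exact (mul_le_mul_of_nonneg_left h1 hκ0.le).trans hκB
      calc (κ * deriv Ψ s) ^ 2 = |κ * deriv Ψ s| ^ 2 := (sq_abs _).symm
        _ ≤ (Real.sqrt (W s0)) ^ 2 := by gcongr
        _ = W s0 := Real.sq_sqrt hw0.le
        _ ≤ W s := hmin hs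
    · have : deriv Ψ s = 0 := by
        rw [mem_Icc, not_and_or, not_le, not_le] at hs
        rcases hs with hs | hs
        · have : Ψ =ᶠ[𝓝 s] fun _ => 0 := by
            filter_upwards [Iio_mem_nhds hs] with x hx using hlow x (le_of_lt hx)
          rw [this.deriv_eq]; simp
        · have : Ψ =ᶠ[𝓝 s] fun _ => 1 := by
            filter_upwards [Ioi_mem_nhds hs] with x hx using hhigh x (le_of_lt hx)
          rw [this.deriv_eq]; simp
      rw [this]; simpa using hW.nonneg s

lemma lim_well {W : ℝ → ℝ} {a b c q l : ℝ} (hW : DoubleWell W a b c q l)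
    {Φ : ℝ → ℝ} {κ : ℝ} (hκ : 0 < κ) (hΦ : Continuous Φ) (ha : Φ a = 0) (hb : Φ b = κ)
    {s : ℕ → ℝ} (hs : Tendsto (fun k => W (s k)) atTop (𝓝 0)) {L : ℝ}
    (hL : Tendsto (fun k => Φ (s k)) atTop (𝓝 L)) :
    ∃ x, (x = a ∨ x = b) ∧ Tendsto s atTop (𝓝 x) := by
  obtain ⟨K, C, hK, hC, hcoer⟩ := W_coer hW
  have hmem : ∀ᶠ k in atTop, s k ∈ Icc (-(K + C)) (K + C) := by
    filter_upwards [hs.eventually_lt_const (show (0:ℝ) < 1 by norm_num)] with k hk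
    rw [mem_Icc, ← abs_le]
    refine (hcoer _).trans ?_
    have := mul_le_mul_of_nonneg_left hk.le hC
    linarith
  have hcl : ∀ y, MapClusterPt y atTop s → (y = a ∨ y = b) ∧ Φ y = L := by
    intro y hy
    obtain ⟨ψ, hψ, hlim⟩ := MapClusterPt.tendsto_subseq hy
    constructor
    · by_contra hne
      rw [not_or] at hne
      have h1 := ((W_contAt hW y hne).tendsto.comp hlim)
      have h2 := hs.comp hψ.tendsto_atTop
      have h3 := tendsto_nhds_unique h1 h2
      rcases (hW.zeros y).1 h3 with h | h
      · exact hne.1 h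
      · exact hne.2 h
    · exact tendsto_nhds_unique ((hΦ.tendsto y).comp hlim) (hL.comp hψ.tendsto_atTop)
  by_cases h0 : L = 0
  · refine ⟨a, Or.inl rfl, isCompact_Icc.tendsto_nhds_of_unique_mapClusterPt hmem ?_⟩
    intro y _ hy
    obtain ⟨h | h, h'⟩ := hcl y hy
    · exact h
    · rw [h, hb, h0] at h'; exact absurd h' hκ.ne'
  · refine ⟨b, Or.inr rfl, isCompact_Icc.tendsto_nhds_of_unique_mapClusterPt hmem ?_⟩
    intro y _ hy
    obtain ⟨h | h, h'⟩ := hcl y hy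
    · rw [h, ha] at h'; exact absurd h'.symm h0
    · exact h

lemma energy_facts {W : ℝ → ℝ} (hWm : Measurable W) (hW0 : ∀ s, 0 ≤ W s)
    {Φ : ℝ → ℝ} (hΦ : ContDiff ℝ 1 Φ) (hΦW : ∀ s, (deriv Φ s) ^ 2 ≤ W s)
    {T : ℝ} {η v : ℝ → ℝ} (hηc : ContinuousOn η (Ioo (-T) T))
    (hηpos : ∀ t ∈ Ioo (-T) T, 0 < η t) (hv : ∀ t ∈ Ioo (-T) T, DifferentiableAt ℝ v t)
    {ε : ℝ} (hε : 0 < ε) {M : ℝ≥0∞} (hM : M ≠ ⊤)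
    (hE : ennEnergy T W η ε v ≤ ENNReal.ofReal ε * M) :
    IntegrableOn (fun t => W (v t) * η t) (Ioo (-T) T) ∧
    (∫ t in Ioo (-T) T, W (v t) * η t) ≤ ε * M.toReal ∧
    IntegrableOn (fun t => |deriv (Φ ∘ v) t| * η t) (Ioo (-T) T) ∧
    (∫ t in Ioo (-T) T, |deriv (Φ ∘ v) t| * η t) ≤ M.toReal := by
  have hvc : ContinuousOn v (Ioo (-T) T) := fun t ht => (hv t ht).continuousAt.continuousWithinAt
  have hvm : AEMeasurable v (volume.restrict (Ioo (-T) T)) := hvc.aemeasurable measurableSet_Ioo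
  have hηm : AEMeasurable η (volume.restrict (Ioo (-T) T)) := hηc.aemeasurable measurableSet_Ioo
  have hWv : AEMeasurable (fun t => W (v t)) (volume.restrict (Ioo (-T) T)) :=
    hWm.comp_aemeasurable hvm
  have hdv : Measurable (deriv v) := measurable_deriv v
  set E : ℝ → ℝ := fun t => (W (v t) + ε ^ 2 * (deriv v t) ^ 2) * η t with hEdef
  have hEm : AEMeasurable E (volume.restrict (Ioo (-T) T)) :=
    (hWv.add ((hdv.pow_const 2).const_mul _).aemeasurable).mul hηm
  have hE0 : ∀ t ∈ Ioo (-T) T, 0 ≤ E t := fun t ht => by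
    have := hW0 (v t); have := hηpos t ht; positivity
  have hE0' : 0 ≤ᵐ[volume.restrict (Ioo (-T) T)] E :=
    (ae_restrict_iff' measurableSet_Ioo).2 (Eventually.of_forall hE0)
  have hfin : ENNReal.ofReal ε * M ≠ ⊤ := ENNReal.mul_ne_top ENNReal.ofReal_ne_top hM
  have hEi : IntegrableOn E (Ioo (-T) T) := by
    refine ⟨hEm.aestronglyMeasurable, ?_⟩
    rw [hasFiniteIntegral_iff_ofReal hE0']
    exact lt_of_le_of_lt hE hfin.lt_top
  have hEle : (∫ t in Ioo (-T) T, E t) ≤ ε * M.toReal := by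
    rw [integral_eq_lintegral_of_nonneg_ae hE0' hEm.aestronglyMeasurable]
    have := ENNReal.toReal_mono hfin hE
    rwa [ENNReal.toReal_mul, ENNReal.toReal_ofReal hε.le] at this
  have b1 : ∀ t ∈ Ioo (-T) T, W (v t) * η t ≤ E t := fun t ht => by
    have := hηpos t ht
    apply mul_le_mul_of_nonneg_right _ this.le
    have : 0 ≤ ε ^ 2 * (deriv v t) ^ 2 := by positivity
    linarith
  have b2 : ∀ t ∈ Ioo (-T) T, |deriv (Φ ∘ v) t| * η t ≤ ε⁻¹ * E t := fun t ht => by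
    have h1 := hηpos t ht
    have hd : deriv (Φ ∘ v) t = deriv Φ (v t) * deriv v t :=
      deriv_comp t ((hΦ.differentiable (by norm_num)) _) (hv t ht)
    rw [hEdef, ← mul_assoc]
    apply mul_le_mul_of_nonneg_right _ h1.le
    rw [hd, abs_mul, inv_mul_eq_div, le_div_iff₀ hε]
    have h2 := hΦW (v t)
    rw [← sq_abs (deriv Φ (v t))] at h2
    rw [← sq_abs (deriv v t)]
    nlinarith [sq_nonneg (|deriv Φ (v t)| - ε * |deriv v t|), sq_nonneg (|deriv Φ (v t)|),
      sq_nonneg (ε * |deriv v t|)]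
  have i1 : IntegrableOn (fun t => W (v t) * η t) (Ioo (-T) T) := by
    refine Integrable.mono' hEi (hWv.mul hηm).aestronglyMeasurable ?_
    refine (ae_restrict_iff' measurableSet_Ioo).2 (Eventually.of_forall fun t ht => ?_)
    rw [Real.norm_of_nonneg (mul_nonneg (hW0 _) (hηpos t ht).le)]
    exact b1 t ht
  have i2 : IntegrableOn (fun t => |deriv (Φ ∘ v) t| * η t) (Ioo (-T) T) := by
    refine Integrable.mono' (hEi.const_mul ε⁻¹)
      ((measurable_deriv _).abs.aemeasurable.mul hηm).aestronglyMeasurable ?_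
    refine (ae_restrict_iff' measurableSet_Ioo).2 (Eventually.of_forall fun t ht => ?_)
    rw [Real.norm_of_nonneg (mul_nonneg (abs_nonneg _) (hηpos t ht).le)]
    exact b2 t ht
  refine ⟨i1, (setIntegral_mono_on i1 hEi measurableSet_Ioo b1).trans hEle, i2, ?_⟩
  refine (setIntegral_mono_on i2 (hEi.const_mul ε⁻¹) measurableSet_Ioo b2).trans ?_
  rw [integral_const_mul]
  calc _ ≤ ε⁻¹ * (ε * M.toReal) := by gcongr
    _ = M.toReal := by field_simp

lemma local_est {η u : ℝ → ℝ} {T : ℝ} (hηpos : ∀ t ∈ Ioo (-T) T, 0 < η t)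
    (hu : ∀ t ∈ Ioo (-T) T, DifferentiableAt ℝ u t)
    (hi : IntegrableOn (fun t => |deriv u t| * η t) (Ioo (-T) T)) {c x y : ℝ} (hc : 0 < c)
    (hxy : x ≤ y) (hsub : Icc x y ⊆ Ioo (-T) T) (hcη : ∀ t ∈ Icc x y, c ≤ η t) :
    |u y - u x| ≤ c⁻¹ * ((∫ t in Iic y, (Ioo (-T) T).indicator (fun t => |deriv u t| * η t) t) -
      ∫ t in Iic x, (Ioo (-T) T).indicator (fun t => |deriv u t| * η t) t) := by
  set G := (Ioo (-T) T).indicator (fun t => |deriv u t| * η t) with hG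
  have hGi : Integrable G := hi.integrable_indicator measurableSet_Ioo
  rw [intervalIntegral.integral_Iic_sub_Iic hGi.integrableOn hGi.integrableOn]
  have hb : ∀ t ∈ Icc x y, ‖deriv u t‖ ≤ c⁻¹ * G t := by
    intro t ht
    rw [hG, indicator_of_mem (hsub ht), Real.norm_eq_abs, inv_mul_eq_div, le_div_iff₀ hc]
    exact mul_le_mul_of_nonneg_left (hcη t ht) (abs_nonneg _)
  have hci : IntervalIntegrable (fun t => c⁻¹ * G t) volume x y :=
    (hGi.const_mul c⁻¹).intervalIntegrable
  have hdi : IntervalIntegrable (deriv u) volume x y := by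
    rw [intervalIntegrable_iff_integrableOn_Ioc_of_le hxy] at hci ⊢
    refine Integrable.mono' hci (measurable_deriv u).aestronglyMeasurable ?_
    exact (ae_restrict_iff' measurableSet_Ioc).2
      (Eventually.of_forall fun t ht => hb t (Ioc_subset_Icc_self ht))
  rw [← intervalIntegral.integral_eq_sub_of_hasDerivAt (f' := deriv u)
    (fun t ht => (hu t (hsub (by rwa [uIcc_of_le hxy] at ht))).hasDerivAt) hdi,
    ← intervalIntegral.integral_const_mul]
  exact intervalIntegral.norm_integral_le_of_norm_le hxy
    (Eventually.of_forall fun t ht => hb t (Ioc_subset_Icc_self ht)) hci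

lemma ibp_est {η u : ℝ → ℝ} {T C A : ℝ} (hηpos : ∀ t ∈ Ioo (-T) T, 0 < η t)
    (hu : ∀ t ∈ Ioo (-T) T, DifferentiableAt ℝ u t) (hub : ∀ t, |u t| ≤ A)
    (hi : IntegrableOn (fun t => |deriv u t| * η t) (Ioo (-T) T))
    (hC : (∫ t in Ioo (-T) T, |deriv u t| * η t) ≤ C)
    {φ : ℝ → ℝ} (hφ : ContDiff ℝ 1 φ) (hcs : HasCompactSupport φ)
    (hts : tsupport φ ⊆ Ioo (-T) T) (hφη : ∀ t ∈ Ioo (-T) T, |φ t| ≤ η t) :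
    (∫ t in Ioo (-T) T, u t * deriv φ t) ≤ C := by
  have hz : ∀ t, t ∉ Ioo (-T) T → φ t = 0 := fun t ht =>
    image_eq_zero_of_notMem_tsupport (fun h => ht (hts h))
  have hz' : ∀ t, t ∉ Ioo (-T) T → deriv φ t = 0 := fun t ht => by
    have := support_deriv_subset (f := φ)
    by_contra h
    exact ht (hts (this h))
  have hφd : Differentiable ℝ φ := hφ.differentiable (by norm_num)
  have huc : ContinuousOn u (Ioo (-T) T) := fun t ht => (hu t ht).continuousAt.continuousWithinAt
  have hum : AEStronglyMeasurable u (volume.restrict (Ioo (-T) T)) :=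
    huc.aestronglyMeasurable measurableSet_Ioo
  have hφ'i : Integrable (deriv φ) :=
    (hφ.continuous_deriv le_rfl).integrable_of_hasCompactSupport hcs.deriv
  have hφi : Integrable φ := hφ.continuous.integrable_of_hasCompactSupport hcs
  -- integrability on the interval
  have j1 : IntegrableOn (fun t => u t * deriv φ t) (Ioo (-T) T) := by
    refine Integrable.mono' (hφ'i.norm.const_mul A).integrableOn
      (hum.mul hφ'i.aestronglyMeasurable.restrict) (Eventually.of_forall fun t => ?_)
    rw [norm_mul]
    exact mul_le_mul_of_nonneg_right (hub t) (norm_nonneg _)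
  have j2 : IntegrableOn (fun t => deriv u t * φ t) (Ioo (-T) T) := by
    refine Integrable.mono' hi
      ((measurable_deriv u).aestronglyMeasurable.mul hφi.aestronglyMeasurable.restrict) ?_
    refine (ae_restrict_iff' measurableSet_Ioo).2 (Eventually.of_forall fun t ht => ?_)
    rw [norm_mul]
    exact mul_le_mul_of_nonneg_left (hφη t ht) (norm_nonneg _)
  have j3 : IntegrableOn (fun t => u t * φ t) (Ioo (-T) T) := by
    refine Integrable.mono' (hφi.norm.const_mul A).integrableOn
      (hum.mul hφi.aestronglyMeasurable.restrict) (Eventually.of_forall fun t => ?_)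
    rw [norm_mul]
    exact mul_le_mul_of_nonneg_right (hub t) (norm_nonneg _)
  have glob : ∀ f : ℝ → ℝ, (∀ t, t ∉ Ioo (-T) T → f t = 0) → IntegrableOn f (Ioo (-T) T) →
      Integrable f := by
    intro f hf hfi
    have : (Ioo (-T) T).indicator f = f := by
      apply indicator_eq_self.2
      intro t ht
      by_contra h
      exact ht (hf t h)
    rw [← this]
    exact hfi.integrable_indicator measurableSet_Ioo
  have hder : ∀ t, HasDerivAt (fun t => u t * φ t) (deriv u t * φ t + u t * deriv φ t) t := by
    intro t
    by_cases ht : t ∈ Ioo (-T) T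
    · exact (hu t ht).hasDerivAt.mul (hφd t).hasDerivAt
    · have hnt : t ∉ tsupport φ := fun h => ht (hts h)
      have hev : (fun t => u t * φ t) =ᶠ[𝓝 t] fun _ => 0 := by
        filter_upwards [(isClosed_tsupport φ).isOpen_compl.mem_nhds hnt] with x hx
        rw [image_eq_zero_of_notMem_tsupport hx, mul_zero]
      rw [hz t ht, hz' t ht]
      simpa using (hasDerivAt_const t (0:ℝ)).congr_of_eventuallyEq hev
  have hsum0 := integral_eq_zero_of_hasDerivAt_of_integrable hder
    (glob _ (fun t ht => by rw [hz t ht, hz' t ht]; simp) (j2.add j1))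
    (glob _ (fun t ht => by rw [hz t ht]; simp) j3)
  rw [← setIntegral_eq_integral_of_forall_compl_eq_zero (s := Ioo (-T) T)
    (fun t ht => by rw [hz t ht, hz' t ht]; simp), integral_add j2 j1] at hsum0
  have hlast : -(∫ t in Ioo (-T) T, deriv u t * φ t) ≤ ∫ t in Ioo (-T) T, |deriv u t| * η t := by
    rw [← integral_neg]
    refine setIntegral_mono_on j2.neg hi measurableSet_Ioo fun t ht => ?_
    calc -(deriv u t * φ t) ≤ |deriv u t * φ t| := neg_le_abs _
      _ = |deriv u t| * |φ t| := abs_mul _ _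
      _ ≤ _ := mul_le_mul_of_nonneg_left (hφη t ht) (abs_nonneg _)
  linarith

/-- **Compactness for bounded first-order energies** (Proposition 4.2).
If `ε_k → 0⁺` and `v_k ∈ H¹_η` satisfy `sup_k (1/ε_k) G_{ε_k}(v_k) < ∞`, then a
subsequence of `(v_k)` converges in `L¹_η` to a function of the class `𝒞`
(a `BV_η` function with values in `{a,b}` satisfying the mass constraint). -/
theorem compactness_1d
    (W : ℝ → ℝ) (a b c q l : ℝ) (hW : DoubleWell W a b c q l)
    (T : ℝ) (hT : 0 < T)
    (η : ℝ → ℝ) (β : ℝ) (n₁ n₂ : ℕ) (d₁ d₂ d₃ d₄ d₅ tstar : ℝ)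
    (hη : GoodWeight T η β n₁ n₂ d₁ d₂ d₃ d₄ d₅ tstar)
    (m : ℝ)
    (hm₁ : a * (∫ t in Set.Ioo (-T) T, η t) < m)
    (hm₂ : m < b * ∫ t in Set.Ioo (-T) T, η t)
    (ε' : ℕ → ℝ) (hε'_pos : ∀ k, 0 < ε' k)
    (hε'_lim : Filter.Tendsto ε' Filter.atTop (𝓝 0))
    (vk : ℕ → (ℝ → ℝ)) (hvk : ∀ k, MemH1 T η (vk k))
    -- `sup_k (1/ε_k) G_{ε_k}(v_k) < ∞`
    (hbd : ∃ M : ℝ≥0∞, M ≠ ⊤ ∧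
      ∀ k, GepsE T W η m (ε' k) (vk k) ≤ ENNReal.ofReal (ε' k) * M) :
    ∃ φ : ℕ → ℕ, StrictMono φ ∧ ∃ v : ℝ → ℝ, memC T η a b m v ∧
      Filter.Tendsto (fun k => dist1 T η (vk (φ k)) v) Filter.atTop (𝓝 0) := by
  classical
  obtain ⟨M, hM, hbd⟩ := hbd
  have hηc : ContinuousOn η (Ioo (-T) T) := hη.smooth.continuousOn
  have hηm : AEStronglyMeasurable η (volume.restrict (Ioo (-T) T)) :=
    hηc.aestronglyMeasurable measurableSet_Ioo
  have hfin : ∀ k, ENNReal.ofReal (ε' k) * M ≠ ⊤ := fun k =>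
    ENNReal.mul_ne_top ENNReal.ofReal_ne_top hM
  have hmass : ∀ k, massEq T η m (vk k) ∧ ennEnergy T W η (ε' k) (vk k) ≤
      ENNReal.ofReal (ε' k) * M := by
    intro k
    have h := hbd k
    unfold GepsE at h
    split_ifs at h with h'
    · exact ⟨h'.2, h⟩
    · exact absurd (top_le_iff.1 h) (hfin k)
  obtain ⟨Φ, κ, hκ, hΦ, hΦr, hΦa, hΦb, hΦW⟩ := Phi_exists hW
  obtain ⟨K, C, hK, hC, hcoer⟩ := W_coer hW
  have hWm := W_meas hW
  have hΦd : Differentiable ℝ Φ := hΦ.differentiable (by norm_num)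
  have hvd : ∀ k, ∀ t ∈ Ioo (-T) T, DifferentiableAt ℝ (vk k) t := fun k => (hvk k).1
  have hud : ∀ k, ∀ t ∈ Ioo (-T) T, DifferentiableAt ℝ (Φ ∘ vk k) t := fun k t ht =>
    (hΦd _).comp t (hvd k t ht)
  have hvm : ∀ k, AEStronglyMeasurable (vk k) (volume.restrict (Ioo (-T) T)) := fun k =>
    ContinuousOn.aestronglyMeasurable
      (fun t ht => (hvd k t ht).continuousAt.continuousWithinAt) measurableSet_Ioo
  have facts := fun k => energy_facts hWm hW.nonneg hΦ hΦW hηc hη.pos (hvd k) (hε'_pos k) hM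
    (hmass k).2
  have hM0 : 0 ≤ M.toReal := ENNReal.toReal_nonneg
  -- Helly selection
  set G : ℕ → ℝ → ℝ := fun k =>
    (Ioo (-T) T).indicator (fun t => |deriv (Φ ∘ vk k) t| * η t) with hGdef
  have hG0 : ∀ k t, 0 ≤ G k t := fun k t =>
    indicator_nonneg (fun t ht => mul_nonneg (abs_nonneg _) (hη.pos t ht).le) t
  have hGi : ∀ k, Integrable (G k) := fun k =>
    (facts k).2.2.1.integrable_indicator measurableSet_Ioo
  have hGM : ∀ k, ∫ t, G k t ≤ M.toReal := fun k => by
    rw [hGdef, integral_indicator measurableSet_Ioo]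
    exact (facts k).2.2.2
  obtain ⟨φ₁, hφ₁, D, hD, hconv⟩ := helly_aux (fun k t => ∫ x in Iic t, G k x)
    (fun k t => Φ (vk k t)) (max M.toReal κ)
    (fun k x y hxy => setIntegral_mono_set (hGi k).integrableOn
      (Eventually.of_forall (hG0 k)) (Iic_subset_Iic.2 hxy).eventuallyLE)
    (fun k t => ⟨integral_nonneg (hG0 k),
      ((setIntegral_le_integral (hGi k) (Eventually.of_forall (hG0 k))).trans
        (hGM k)).trans (le_max_left _ _)⟩)
    (fun k t => ⟨(hΦr _).1, (hΦr _).2.trans (le_max_right _ _)⟩) (Ioo (-T) T) (by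
      intro t ht
      have h1 : ∀ᶠ x in 𝓝 t, x ∈ Ioo (-T) T ∧ η t / 2 < η x :=
        Eventually.and (isOpen_Ioo.mem_nhds ht)
          ((hηc.continuousAt (isOpen_Ioo.mem_nhds ht)).eventually_const_lt
            (by have := hη.pos t ht; linarith))
      obtain ⟨δ, hδ, hb⟩ := Metric.eventually_nhds_iff_ball.1 h1
      have hp := hη.pos t ht
      refine ⟨(η t / 2)⁻¹, by positivity, δ, hδ, fun k x hx y hy hxy => ?_⟩
      have hs : ∀ z ∈ Icc x y, z ∈ Metric.ball t δ := by
        intro z hz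
        rw [Real.ball_eq_Ioo]
        exact ⟨hx.1.trans_le hz.1, hz.2.trans_lt hy.2⟩
      exact local_est hη.pos (hud k) (facts k).2.2.1 (by positivity) hxy
        (fun z hz => (hb z (hs z hz)).1) (fun z hz => (hb z (hs z hz)).2.le))
  -- a.e. convergence of the potential
  have hWint : Tendsto (fun k => ∫ t in Ioo (-T) T, W (vk k t) * η t) atTop (𝓝 0) := by
    refine squeeze_zero (fun k => setIntegral_nonneg measurableSet_Ioo
      fun t ht => mul_nonneg (hW.nonneg _) (hη.pos t ht).le) (fun k => (facts k).2.1) ?_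
    simpa using hε'_lim.mul_const M.toReal
  have hWint₁ := hWint.comp hφ₁.tendsto_atTop
  have hmeas : TendstoInMeasure (volume.restrict (Ioo (-T) T))
      (fun k t => W (vk (φ₁ k) t) * η t) atTop (fun _ => (0:ℝ)) := by
    refine tendstoInMeasure_of_tendsto_eLpNorm (p := 1) one_ne_zero
      (fun k => (facts (φ₁ k)).1.aestronglyMeasurable) aestronglyMeasurable_const ?_
    have : ∀ k, eLpNorm ((fun t => W (vk (φ₁ k) t) * η t) - fun _ => (0:ℝ)) 1
        (volume.restrict (Ioo (-T) T)) =
        ENNReal.ofReal (∫ t in Ioo (-T) T, W (vk (φ₁ k) t) * η t) := by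
      intro k
      have e : ((fun t => W (vk (φ₁ k) t) * η t) - fun _ => (0:ℝ)) =
        fun t => W (vk (φ₁ k) t) * η t := by ext t; simp
      rw [e, eLpNorm_one_eq_lintegral_enorm, ← ofReal_integral_norm_eq_lintegral_enorm
        (facts (φ₁ k)).1]
      congr 1
      refine setIntegral_congr_fun measurableSet_Ioo fun t ht => ?_
      exact Real.norm_of_nonneg (mul_nonneg (hW.nonneg _) (hη.pos t ht).le)
    simp_rw [this]
    have h0 := (ENNReal.continuous_ofReal.tendsto 0).comp hWint₁
    rw [ENNReal.ofReal_zero] at h0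
    exact h0
  obtain ⟨φ₂, hφ₂, hae⟩ := hmeas.exists_seq_tendsto_ae
  set ψ : ℕ → ℕ := φ₁ ∘ φ₂ with hψ
  have hψm : StrictMono ψ := hφ₁.comp hφ₂
  have haeD : ∀ᵐ t ∂(volume.restrict (Ioo (-T) T)), t ∉ D :=
    ae_restrict_of_ae (measure_eq_zero_iff_ae_notMem.1 (hD.measure_zero _))
  have hpt : ∀ᵐ t ∂(volume.restrict (Ioo (-T) T)),
      ∃ x, (x = a ∨ x = b) ∧ Tendsto (fun k => vk (ψ k) t) atTop (𝓝 x) := by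
    filter_upwards [hae, haeD, ae_restrict_mem measurableSet_Ioo] with t h1 h2 ht
    obtain ⟨L, hL⟩ := hconv t ht h2
    have hp := hη.pos t ht
    refine lim_well hW hκ hΦ.continuous hΦa hΦb (s := fun k => vk (ψ k) t) ?_
      (hL.comp hφ₂.tendsto_atTop)
    have := h1.mul_const (η t)⁻¹
    simp only [zero_mul] at this
    refine this.congr fun k => ?_
    field_simp
    rfl
  obtain ⟨v, hvmeas, hvlim⟩ := measurable_limit_of_tendsto_metrizable_ae (L := atTop)
    (fun k => (hvm (ψ k)).aemeasurable) (hpt.mono fun t ⟨x, _, h⟩ => ⟨x, h⟩)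
  have hvab : ∀ᵐ t ∂(volume.restrict (Ioo (-T) T)), v t = a ∨ v t = b := by
    filter_upwards [hpt, hvlim] with t ⟨x, hx, h⟩ h'
    rw [tendsto_nhds_unique h' h]; exact hx
  set B := max |a| |b| with hB
  have hB0 : 0 ≤ B := (abs_nonneg a).trans (le_max_left _ _)
  have hvB : ∀ᵐ t ∂(volume.restrict (Ioo (-T) T)), |v t| ≤ B := by
    filter_upwards [hvab] with t h
    rcases h with h | h <;> rw [h]
    exacts [le_max_left _ _, le_max_right _ _]
  have hηpos : ∀ᵐ t ∂(volume.restrict (Ioo (-T) T)), 0 < η t := by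
    filter_upwards [ae_restrict_mem measurableSet_Ioo] with t ht using hη.pos t ht
  have hηi : Integrable η (volume.restrict (Ioo (-T) T)) := hη.integrable
  have hvi : Integrable (fun t => v t * η t) (volume.restrict (Ioo (-T) T)) := by
    refine Integrable.mono' (hηi.const_mul B) (hvmeas.aestronglyMeasurable.mul hηm) ?_
    filter_upwards [hvB, hηpos] with t h1 h2
    rw [norm_mul, Real.norm_of_nonneg h2.le]
    exact mul_le_mul_of_nonneg_right h1 h2.le
  have hvki : ∀ k, Integrable (fun t => vk k t * η t) (volume.restrict (Ioo (-T) T)) := by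
    intro k
    refine Integrable.mono' ((hηi.const_mul K).add ((facts k).1.const_mul C)) ((hvm k).mul hηm) ?_
    filter_upwards [hηpos] with t h2
    rw [norm_mul, Real.norm_of_nonneg h2.le]
    have := mul_le_mul_of_nonneg_right (hcoer (vk k t)) h2.le
    simp only [Pi.add_apply, Real.norm_eq_abs]
    linarith
  have hdi : ∀ k, Integrable (fun t => |vk k t - v t| * η t)
      (volume.restrict (Ioo (-T) T)) := by
    intro k
    refine ((hvki k).sub hvi).norm.congr ?_
    filter_upwards [hηpos] with t h2
    simp only [Pi.sub_apply, Real.norm_eq_abs]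
    rw [← sub_mul, abs_mul, abs_of_pos h2]
  -- convergence in weighted L1
  have hdct : Tendsto (fun k => ∫ t in Ioo (-T) T, min |vk (ψ k) t - v t| (K + B) * η t)
      atTop (𝓝 (∫ t in Ioo (-T) T, (0:ℝ))) := by
    refine tendsto_integral_of_dominated_convergence (fun t => (K + B) * η t) ?_
      (hηi.const_mul _) ?_ ?_
    · intro k
      exact (((hvm _).sub hvmeas.aestronglyMeasurable).norm.inf
        aestronglyMeasurable_const).mul hηm
    · intro k
      filter_upwards [hηpos] with t h2
      rw [norm_mul, Real.norm_of_nonneg h2.le, Real.norm_of_nonneg (by positivity)]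
      exact mul_le_mul_of_nonneg_right (min_le_right _ _) h2.le
    · filter_upwards [hvlim] with t h
      have h1 : Tendsto (fun k => |vk (ψ k) t - v t|) atTop (𝓝 0) := by
        simpa using (h.sub_const (v t)).abs
      have h2 := (h1.min (tendsto_const_nhds (x := K + B))).mul_const (η t)
      rwa [min_eq_left (by positivity), zero_mul] at h2
  have hdist : Tendsto (fun k => dist1 T η (vk (ψ k)) v) atTop (𝓝 0) := by
    have hup := hdct.add ((hWint.comp hψm.tendsto_atTop).const_mul C)
    simp only [integral_zero, mul_zero, add_zero] at hup
    refine squeeze_zero (fun k => setIntegral_nonneg measurableSet_Ioo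
      fun t ht => mul_nonneg (abs_nonneg _) (hη.pos t ht).le) (fun k => ?_) hup
    have hmi : Integrable (fun t => min |vk (ψ k) t - v t| (K + B) * η t)
        (volume.restrict (Ioo (-T) T)) := by
      refine Integrable.mono' (hdi (ψ k)) ((((hvm _).sub hvmeas.aestronglyMeasurable).norm.inf
        aestronglyMeasurable_const).mul hηm) ?_
      filter_upwards [hηpos] with t h2
      rw [norm_mul, Real.norm_of_nonneg h2.le, Real.norm_of_nonneg (by positivity)]
      exact mul_le_mul_of_nonneg_right (min_le_left _ _) h2.le
    simp only [Function.comp_apply]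
    rw [← integral_const_mul, ← integral_add hmi ((facts (ψ k)).1.const_mul C)]
    refine integral_mono_ae (hdi (ψ k)) (hmi.add ((facts (ψ k)).1.const_mul C)) ?_
    filter_upwards [hηpos, hvB] with t h2 h3
    rw [← mul_assoc, ← add_mul]
    refine mul_le_mul_of_nonneg_right ?_ h2.le
    have h4 := hcoer (vk (ψ k) t)
    have h5 := abs_sub (vk (ψ k) t) (v t)
    have h6 : 0 ≤ C * W (vk (ψ k) t) := mul_nonneg hC (hW.nonneg _)
    rcases le_total |vk (ψ k) t - v t| (K + B) with h | h
    · rw [min_eq_left h]; linarith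
    · rw [min_eq_right h]; linarith
  refine ⟨ψ, hψm, v, ⟨hvab, ?_, ?_⟩, hdist⟩
  · -- bounded weighted variation
    refine ⟨(b - a) / κ * M.toReal, ?_⟩
    rintro r ⟨φ, hφ, hcs, hts, hφη, rfl⟩
    have hba : 0 < (b - a) / κ := div_pos (by linarith [hW.lt_ab]) hκ
    set g : ℕ → ℝ → ℝ := fun k t => a + (b - a) / κ * Φ (vk k t) with hg
    have hgder : ∀ k t, deriv (g k) t = (b - a) / κ * deriv (Φ ∘ vk k) t := by
      intro k t
      rw [hg]
      simp only [deriv_const_add]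
      exact deriv_const_mul_field _
    have hgb : ∀ k t, |g k t| ≤ |a| + (b - a) := by
      intro k t
      refine (abs_add_le _ _).trans ?_
      have h1 := hΦr (vk k t)
      rw [abs_of_nonneg (mul_nonneg hba.le h1.1)]
      have : (b - a) / κ * Φ (vk k t) ≤ (b - a) / κ * κ := mul_le_mul_of_nonneg_left h1.2 hba.le
      rw [div_mul_cancel₀ _ hκ.ne'] at this
      linarith
    have hgi : ∀ k, ∀ t, |deriv (g k) t| * η t = (b - a) / κ * (|deriv (Φ ∘ vk k) t| * η t) := by
      intro k t
      rw [hgder, abs_mul, abs_of_pos hba, mul_assoc]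
    have hgle : ∀ k, (∫ t in Ioo (-T) T, g k t * deriv φ t) ≤ (b - a) / κ * M.toReal := by
      intro k
      refine ibp_est hη.pos (fun t ht => ((hud k t ht).const_mul _).const_add a) (hgb k) ?_ ?_
        hφ hcs hts hφη
      · exact ((facts k).2.2.1.const_mul ((b - a) / κ)).congr
          (Eventually.of_forall fun t => (hgi k t).symm)
      · refine (integral_congr_ae (Eventually.of_forall fun t => hgi k t)).trans_le ?_
        rw [integral_const_mul]
        exact mul_le_mul_of_nonneg_left (facts k).2.2.2 hba.le
    have hφ'i : Integrable (deriv φ) :=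
      (hφ.continuous_deriv le_rfl).integrable_of_hasCompactSupport hcs.deriv
    have hlim : Tendsto (fun k => ∫ t in Ioo (-T) T, g (ψ k) t * deriv φ t) atTop
        (𝓝 (∫ t in Ioo (-T) T, v t * deriv φ t)) := by
      refine tendsto_integral_of_dominated_convergence
        (fun t => (|a| + (b - a)) * ‖deriv φ t‖) ?_
        (hφ'i.norm.const_mul _).integrableOn ?_ ?_
      · intro k
        exact (((hΦ.continuous.comp_aestronglyMeasurable (hvm (ψ k))).const_mul _).const_add
          a).mul hφ'i.aestronglyMeasurable.restrict
      · intro k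
        refine Eventually.of_forall fun t => ?_
        rw [norm_mul]
        exact mul_le_mul_of_nonneg_right (hgb _ t) (norm_nonneg _)
      · filter_upwards [hvlim, hvab] with t h1 h2
        have h3 := ((((hΦ.continuous.tendsto (v t)).comp h1).const_mul ((b - a) / κ)).const_add
          a).mul_const (deriv φ t)
        have h4 : a + (b - a) / κ * Φ (v t) = v t := by
          rcases h2 with h | h
          · rw [h, hΦa]; ring
          · rw [h, hΦb, div_mul_cancel₀ _ hκ.ne']; ring
        rw [h4] at h3
        exact h3
    exact le_of_tendsto' hlim fun k => hgle (ψ k)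
  · -- mass constraint
    have h1 : Tendsto (fun _ : ℕ => m - ∫ t in Ioo (-T) T, v t * η t) atTop (𝓝 0) := by
      refine squeeze_zero_norm (fun k => ?_) hdist
      have hk : (∫ t in Ioo (-T) T, vk (ψ k) t * η t) = m := (hmass (ψ k)).1
      rw [← hk, ← integral_sub (hvki _) hvi]
      refine (norm_integral_le_integral_norm _).trans (le_of_eq ?_)
      refine integral_congr_ae ?_
      filter_upwards [hηpos] with t h2
      rw [Real.norm_eq_abs, ← sub_mul, abs_mul, abs_of_pos h2]
    have h2 := tendsto_nhds_unique tendsto_const_nhds h1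
    unfold massEq
    linarith
end

section
/- The single-interface configuration is an isolated local minimizer of the first-order Gamma-limit: there exists delta > 0 such that v_0 is an isolated delta-local minimizer of G^(1) in L^1_eta, i.e. there is no v_1 in the class C with 0 < || v_1 - v_0 ||_{L^1_eta} <= delta and G^(1)(v_1) <= G^(1)(v_0) = 2 c_W eta(t_0). -/
open MeasureTheory Set Filter Topology Asymptotics
open scoped ENNReal Classical

theorem aux_bdd_near (f f' f'' : ℝ → ℝ) (ε K q : ℝ) (hε : 0 < ε) (hq : 0 < q) (hK : 0 ≤ K)
    (h1 : ∀ s ∈ Ioo 0 ε, HasDerivAt f (f' s) s)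
    (h2 : ∀ s ∈ Ioo 0 ε, HasDerivAt f' (f'' s) s)
    (h3 : ∀ s ∈ Ioo 0 ε, f'' s ≤ K * s ^ (q - 1)) :
    ∃ r ∈ Ioo 0 ε, ∃ M, ∀ s ∈ Ioo 0 r, f s ≤ M := by
  have hg : ∀ s ∈ Ioo 0 ε, HasDerivAt (fun s => f' s - K / q * s ^ q)
      (f'' s - K / q * (q * s ^ (q - 1))) s := by
    intro s hs
    exact (h2 s hs).sub ((Real.hasDerivAt_rpow_const (Or.inl hs.1.ne')).const_mul _)
  have hanti : AntitoneOn (fun s => f' s - K / q * s ^ q) (Ioo 0 ε) := by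
    apply antitoneOn_of_deriv_nonpos (convex_Ioo 0 ε)
    · intro s hs; exact (hg s hs).continuousAt.continuousWithinAt
    · intro s hs; rw [interior_Ioo] at hs
      exact (hg s hs).differentiableAt.differentiableWithinAt
    · intro s hs; rw [interior_Ioo] at hs
      rw [(hg s hs).deriv]
      have := h3 s hs
      have e : K / q * (q * s ^ (q - 1)) = K * s ^ (q - 1) := by field_simp
      rw [e]; linarith
  have hr : ε / 2 ∈ Ioo 0 ε := ⟨by linarith, by linarith⟩
  set r := ε / 2 with hrdef
  set N := f' r - K / q * r ^ q with hN
  have hlow : ∀ s ∈ Ioc 0 r, N ≤ f' s := by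
    intro s hs
    have := hanti ⟨hs.1, hs.2.trans_lt hr.2⟩ hr hs.2
    have h0 : 0 ≤ K / q * s ^ q := by
      have := Real.rpow_nonneg hs.1.le q
      positivity
    simp only at this
    linarith
  have hg2 : ∀ s ∈ Ioc 0 r, HasDerivAt (fun s => f s - N * s) (f' s - N * 1) s := by
    intro s hs
    exact (h1 s ⟨hs.1, hs.2.trans_lt hr.2⟩).sub ((hasDerivAt_id s).const_mul N)
  have hmono : MonotoneOn (fun s => f s - N * s) (Ioc 0 r) := by
    apply monotoneOn_of_deriv_nonneg (convex_Ioc 0 r)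
    · intro s hs; exact (hg2 s hs).continuousAt.continuousWithinAt
    · intro s hs; rw [interior_Ioc] at hs
      exact (hg2 s ⟨hs.1, hs.2.le⟩).differentiableAt.differentiableWithinAt
    · intro s hs; rw [interior_Ioc] at hs
      rw [(hg2 s ⟨hs.1, hs.2.le⟩).deriv]
      have := hlow s ⟨hs.1, hs.2.le⟩
      linarith
  refine ⟨r, hr, f r - N * r + |N| * r, fun s hs => ?_⟩
  have := hmono ⟨hs.1, hs.2.le⟩ ⟨hr.1, le_refl r⟩ hs.2.le
  simp only at this
  have h4 : N * s ≤ |N| * r := by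
    calc N * s ≤ |N| * s := mul_le_mul_of_nonneg_right (le_abs_self N) hs.1.le
      _ ≤ _ := mul_le_mul_of_nonneg_left hs.2.le (abs_nonneg N)
  linarith

theorem aux_ev (g : ℝ → ℝ) (p q l : ℝ) (hl : 0 < l)
    (h : Tendsto (fun s => g s / |s - p| ^ (q - 1)) (𝓝[≠] p) (𝓝 l)) :
    ∃ ε > 0, ∀ s, s ≠ p → |s - p| < ε → g s ≤ 2 * l * |s - p| ^ (q - 1) := by
  have h1 : ∀ᶠ s in 𝓝[≠] p, g s / |s - p| ^ (q - 1) < 2 * l :=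
    h.eventually_lt_const (by linarith)
  rw [eventually_nhdsWithin_iff, Metric.eventually_nhds_iff] at h1
  obtain ⟨ε, hε, h1⟩ := h1
  refine ⟨ε, hε, fun s hs hd => ?_⟩
  have h2 := h1 (y := s) (by rwa [Real.dist_eq]) hs
  have h3 : 0 < |s - p| ^ (q - 1) := Real.rpow_pos_of_pos (abs_pos.mpr (sub_ne_zero.mpr hs)) _
  rw [div_lt_iff₀ h3] at h2
  exact h2.le

theorem aux_cW_pos (W : ℝ → ℝ) (a b c q l : ℝ) (hW : DoubleWell W a b c q l) :
    0 < ∫ s in a..b, Real.sqrt (W s) := by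
  have hab := hW.lt_ab
  have hq := hW.q_mem.1
  have hl := hW.l_pos
  have hopen : IsOpen (({a, b} : Set ℝ)ᶜ) := (Set.toFinite _).isClosed.isOpen_compl
  have hd1 : ∀ s ∈ (({a, b} : Set ℝ)ᶜ), HasDerivAt W (deriv W s) s := by
    intro s hs
    have := (hW.smooth.contDiffAt (hopen.mem_nhds hs)).differentiableAt (by norm_num)
    exact this.hasDerivAt
  have hd2 : ∀ s ∈ (({a, b} : Set ℝ)ᶜ), HasDerivAt (deriv W) (deriv (deriv W) s) s := by
    intro s hs
    have h2 : ContDiffOn ℝ 1 (deriv W) (({a, b} : Set ℝ)ᶜ) :=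
      hW.smooth.deriv_of_isOpen hopen (by norm_num)
    have := (h2.contDiffAt (hopen.mem_nhds hs)).differentiableAt (by norm_num)
    exact this.hasDerivAt
  have hmem : ∀ s, a < s → s < b → s ∈ (({a, b} : Set ℝ)ᶜ) := by
    intro s h1 h2
    simp only [mem_compl_iff, mem_insert_iff, mem_singleton_iff, not_or]
    exact ⟨h1.ne', h2.ne⟩
  obtain ⟨ε₁, hε₁, hA⟩ := aux_ev _ _ _ _ hl hW.lim_a
  obtain ⟨ε₂, hε₂, hB⟩ := aux_ev _ _ _ _ hl hW.lim_b
  obtain ⟨r₁, hr₁, M₁, hM₁⟩ := aux_bdd_near (fun s => W (a + s)) (fun s => deriv W (a + s))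
    (fun s => deriv (deriv W) (a + s)) (min ε₁ (b - a)) (2 * l) q
    (lt_min hε₁ (by linarith)) hq (by linarith)
    (by
      intro s hs
      have := lt_min_iff.1 hs.2
      exact (hd1 (a + s) (hmem _ (by linarith [hs.1]) (by linarith))).comp_const_add a s)
    (by
      intro s hs
      have := lt_min_iff.1 hs.2
      exact (hd2 (a + s) (hmem _ (by linarith [hs.1]) (by linarith))).comp_const_add a s)
    (by
      intro s hs
      have := lt_min_iff.1 hs.2
      have h := hA (a + s) (by linarith [hs.1]) (by
        rw [add_sub_cancel_left, abs_of_pos hs.1]; exact this.1)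
      rwa [add_sub_cancel_left, abs_of_pos hs.1] at h)
  obtain ⟨r₂, hr₂, M₂, hM₂⟩ := aux_bdd_near (fun s => W (b - s)) (fun s => - deriv W (b - s))
    (fun s => deriv (deriv W) (b - s)) (min ε₂ (b - a)) (2 * l) q
    (lt_min hε₂ (by linarith)) hq (by linarith)
    (by
      intro s hs
      have := lt_min_iff.1 hs.2
      exact (hd1 (b - s) (hmem _ (by linarith) (by linarith [hs.1]))).comp_const_sub b s)
    (by
      intro s hs
      have := lt_min_iff.1 hs.2
      have := ((hd2 (b - s) (hmem _ (by linarith) (by linarith [hs.1]))).comp_const_sub b s).neg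
      rwa [neg_neg] at this)
    (by
      intro s hs
      have := lt_min_iff.1 hs.2
      have e : |b - s - b| = s := by
        rw [show b - s - b = -s by ring, abs_neg, abs_of_pos hs.1]
      have h := hB (b - s) (by linarith [hs.1]) (by rw [e]; exact this.1)
      rwa [e] at h)
  have hcont : ContinuousOn W (Ioo a b) := fun s hs =>
    (hd1 s (hmem s hs.1 hs.2)).continuousAt.continuousWithinAt
  have hr1 := (lt_min_iff.1 hr₁.2).2
  have hr2 := (lt_min_iff.1 hr₂.2).2
  obtain ⟨M₃, hM₃⟩ := (isCompact_Icc (a := a + r₁) (b := b - r₂)).bddAbove_image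
    (hcont.mono (fun s hs => ⟨by linarith [hs.1, hr₁.1], by linarith [hs.2, hr₂.1]⟩))
  have hbd : ∀ s ∈ Ioo a b, W s ≤ |M₁| + |M₂| + |M₃| := by
    intro s hs
    have p1 := abs_nonneg M₁
    have p2 := abs_nonneg M₂
    have p3 := abs_nonneg M₃
    by_cases c1 : s < a + r₁
    · have := hM₁ (s - a) ⟨by linarith [hs.1], by linarith⟩
      simp only [add_sub_cancel] at this
      linarith [le_abs_self M₁]
    by_cases c2 : b - r₂ < s
    · have := hM₂ (b - s) ⟨by linarith [hs.2], by linarith⟩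
      simp only [sub_sub_cancel] at this
      linarith [le_abs_self M₂]
    have := hM₃ (mem_image_of_mem W (show s ∈ Icc (a + r₁) (b - r₂) from ⟨by linarith, by linarith⟩))
    linarith [le_abs_self M₃]
  have hsqrtint : IntegrableOn (fun s => Real.sqrt (W s)) (Ioo a b) := by
    refine Integrable.of_bound (C := Real.sqrt (|M₁| + |M₂| + |M₃|)) ?_ ?_
    · exact (hcont.sqrt).aestronglyMeasurable measurableSet_Ioo
    · refine (ae_restrict_iff' measurableSet_Ioo).2 (ae_of_all _ fun s hs => ?_)
      rw [Real.norm_eq_abs, abs_of_nonneg (Real.sqrt_nonneg _)]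
      exact Real.sqrt_le_sqrt (hbd s hs)
  apply intervalIntegral.intervalIntegral_pos_of_pos_on _ _ hab
  · rw [intervalIntegrable_iff_integrableOn_Ioo_of_le hab.le]; exact hsqrtint
  · intro s hs
    apply Real.sqrt_pos.2
    refine lt_of_le_of_ne (hW.nonneg s) (fun h => ?_)
    rcases (hW.zeros s).1 h.symm with h | h
    · exact hs.1.ne' h
    · exact hs.2.ne h

theorem aux_mollifier (u : ℝ → ℝ) (hu : LocallyIntegrable u) :
    ∃ (Ψ : ℕ → ℝ → ℝ) (h : ℕ → ℝ), (∀ n, ContDiff ℝ 1 (Ψ n)) ∧ (∀ n, Monotone (Ψ n)) ∧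
      (∀ n, 0 < h n) ∧ Tendsto h atTop (𝓝 0) ∧ (∀ n t, t ≤ - h n → Ψ n t = 0) ∧
      (∀ n t, h n ≤ t → Ψ n t = 1) ∧
      ∀ᵐ x, Tendsto (fun n => ∫ t, u t * deriv (Ψ n) (t - x)) atTop (𝓝 (u x)) := by
  let φ : ℕ → ContDiffBump (0 : ℝ) := fun n =>
    ⟨1 / ((n : ℝ) + 1) / 4, 1 / ((n : ℝ) + 1) / 2, by positivity, by
      have : 0 < 1 / ((n : ℝ) + 1) := by positivity
      linarith⟩
  have hout : ∀ n, (φ n).rOut = 1 / ((n : ℝ) + 1) / 2 := fun n => rfl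
  have hin : ∀ n, (φ n).rIn = 1 / ((n : ℝ) + 1) / 4 := fun n => rfl
  have hle : ∀ n, (φ n).rOut ≤ 1 / 2 := by
    intro n
    rw [hout]
    have : 1 / ((n : ℝ) + 1) ≤ 1 := by
      rw [div_le_one (by positivity)]; linarith [Nat.cast_nonneg (α := ℝ) n]
    linarith
  have hlim : Tendsto (fun n => (φ n).rOut) atTop (𝓝 0) := by
    simp only [hout]
    have := (tendsto_one_div_add_atTop_nhds_zero_nat (𝕜 := ℝ)).div_const 2
    simpa using this
  have hconv := ContDiffBump.ae_convolution_tendsto_right_of_locallyIntegrable (μ := volume)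
    (φ := φ) (K := 2) hlim (Eventually.of_forall fun n => by
      rw [hout, hin]; apply le_of_eq; ring) hu
  let ψ : ℕ → ℝ → ℝ := fun n => (φ n).normed volume
  have hψc : ∀ n, Continuous (ψ n) := fun n => (φ n).continuous_normed
  have hψ0 : ∀ n t, 0 ≤ ψ n t := fun n t => (φ n).nonneg_normed t
  have hsupp : ∀ n, Function.support (ψ n) = Ioo (-(φ n).rOut) ((φ n).rOut) := by
    intro n
    have := (φ n).support_normed_eq (μ := volume)
    rw [Real.ball_eq_Ioo, zero_sub, zero_add] at this
    exact this
  have hψi : ∀ n x y, IntervalIntegrable (ψ n) volume x y := fun n x y =>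
    (hψc n).intervalIntegrable x y
  have hder : ∀ n t, HasDerivAt (fun t => ∫ s in (-1)..t, ψ n s) (ψ n t) t := fun n t =>
    (hψc n).integral_hasStrictDerivAt (-1) t |>.hasDerivAt
  have hder' : ∀ n, deriv (fun t => ∫ s in (-1)..t, ψ n s) = ψ n := fun n =>
    funext fun t => (hder n t).deriv
  refine ⟨fun n t => ∫ s in (-1)..t, ψ n s, fun n => (φ n).rOut, ?_, ?_, ?_, hlim, ?_, ?_, ?_⟩
  · intro n
    rw [contDiff_one_iff_deriv, hder']
    exact ⟨fun t => (hder n t).differentiableAt, hψc n⟩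
  · intro n
    apply monotone_of_deriv_nonneg (fun t => (hder n t).differentiableAt)
    intro t
    rw [hder']; exact hψ0 n t
  · intro n; exact (φ n).rOut_pos
  · intro n t ht
    have : ∀ s ∈ uIcc (-1) t, ψ n s = 0 := by
      intro s hs
      have h2 : s ≤ -(φ n).rOut := by
        have h3 : s ≤ max (-1) t := hs.2
        refine h3.trans (max_le ?_ ht)
        linarith [hle n]
      by_contra hne
      have h4 : s ∈ Function.support (ψ n) := hne
      rw [hsupp] at h4
      linarith [h4.1]
    show ∫ s in (-1)..t, ψ n s = 0
    rw [intervalIntegral.integral_congr (g := fun _ => (0 : ℝ)) this]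
    simp
  · intro n t ht
    show ∫ s in (-1)..t, ψ n s = 1
    rw [intervalIntegral.integral_eq_integral_of_support_subset]
    · exact (φ n).integral_normed
    · rw [hsupp]
      intro s hs
      exact ⟨by linarith [hs.1, hle n], by linarith [hs.2]⟩
  · filter_upwards [hconv] with x hx
    refine hx.congr fun n => ?_
    rw [hder', convolution_eq_swap]
    congr 1
    funext t
    simp only [ContinuousLinearMap.lsmul_apply, smul_eq_mul]
    rw [mul_comm, ← neg_sub, ContDiffBump.normed_neg]

/-- jump points of `u` relative to the good set `S` -/
def IsJump (S : Set ℝ) (u : ℝ → ℝ) (p : ℝ) : Prop :=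
  ∀ ε > 0, ∃ x ∈ S, ∃ y ∈ S, p - ε < x ∧ x < y ∧ y < p + ε ∧ u x ≠ u y

theorem aux_exists_jump (S : Set ℝ) (u : ℝ → ℝ)
    (lo hi : ℝ) (hS : ∀ x y, lo ≤ x → y ≤ hi → x < y → ∃ z ∈ S, x < z ∧ z < y)
    (x y : ℝ) (hx : x ∈ S) (hy : y ∈ S) (hxy : x < y) (hlx : lo ≤ x) (hyh : y ≤ hi)
    (hne : u x ≠ u y) : ∃ p, x ≤ p ∧ p ≤ y ∧ IsJump S u p := by
  set Z : Set ℝ := {z | z ∈ S ∧ x ≤ z ∧ z ≤ y ∧ u z = u x} with hZ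
  have hxZ : x ∈ Z := ⟨hx, le_refl _, hxy.le, rfl⟩
  have hbd : BddAbove Z := ⟨y, fun z hz => hz.2.2.1⟩
  set p := sSup Z with hp
  have hxp : x ≤ p := le_csSup hbd hxZ
  have hpy : p ≤ y := csSup_le ⟨x, hxZ⟩ fun z hz => hz.2.2.1
  refine ⟨p, hxp, hpy, fun ε hε => ?_⟩
  obtain ⟨z, hz, hzp⟩ := exists_lt_of_lt_csSup ⟨x, hxZ⟩ (show p - ε < p by linarith)
  have hzle : z ≤ p := le_csSup hbd hz
  rcases hpy.lt_or_eq with h | h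
  · obtain ⟨w, hw, hw1, hw2⟩ := hS p (min y (p + ε)) (hlx.trans hxp)
      ((min_le_left _ _).trans hyh) (lt_min h (by linarith))
    have := lt_min_iff.1 hw2
    refine ⟨z, hz.1, w, hw, hzp, by linarith, this.2, fun he => ?_⟩
    have : w ∈ Z := ⟨hw, by linarith, by linarith, by rw [← he, hz.2.2.2]⟩
    linarith [le_csSup hbd this]
  · refine ⟨z, hz.1, y, hy, hzp, ?_, by linarith, ?_⟩
    · rcases hz.2.2.1.lt_or_eq with h1 | h1
      · exact h1
      · exfalso; apply hne; rw [← hz.2.2.2, h1]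
    · rw [hz.2.2.2]; exact hne

theorem aux_int_mul (T : ℝ) (v g : ℝ → ℝ) (hv : IntegrableOn v (Ioo (-T) T))
    (hg : Continuous g) : IntegrableOn (fun t => v t * g t) (Ioo (-T) T) :=
  IntegrableOn.mul_continuousOn_of_subset hv hg.continuousOn measurableSet_Ioo
    (isCompact_Icc (a := -T) (b := T)) Ioo_subset_Icc_self

theorem aux_test (T a b : ℝ) (v : ℝ → ℝ) (hab : a < b)
    (hv : IntegrableOn v (Ioo (-T) T)) (Ψ : ℕ → ℝ → ℝ) (h : ℕ → ℝ)
    (hC : ∀ n, ContDiff ℝ 1 (Ψ n)) (hmono : ∀ n, Monotone (Ψ n))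
    (hh : ∀ n, 0 < h n) (hlim : Tendsto h atTop (𝓝 0)) (h0 : ∀ n t, t ≤ - h n → Ψ n t = 0)
    (h1 : ∀ n t, h n ≤ t → Ψ n t = 1)
    (S : Set ℝ) (hS : ∀ x ∈ S, (v x = a ∨ v x = b) ∧
      Tendsto (fun n => ∫ t in Ioo (-T) T, v t * deriv (Ψ n) (t - x)) atTop (𝓝 (v x)))
    (x y α β k : ℝ) (hx : x ∈ S) (hy : y ∈ S) (hxy : x < y) (hne : v x ≠ v y)
    (hα : α < x) (hβ : y < β) (hk : 0 ≤ k) :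
    ∃ Φ : ℕ → ℝ → ℝ, (∀ n, ContDiff ℝ 1 (Φ n)) ∧
      (∀ᶠ n in atTop, ∀ t, t ∉ Icc α β → Φ n t = 0) ∧
      (∀ n t, |Φ n t| ≤ k) ∧
      Tendsto (fun n => ∫ t in Ioo (-T) T, v t * deriv (Φ n) t) atTop (𝓝 (k * (b - a))) := by
  obtain ⟨σ, hσ, hσv⟩ : ∃ σ : ℝ, |σ| = 1 ∧ σ * (v x - v y) = b - a := by
    rcases (hS x hx).1 with h2 | h2 <;> rcases (hS y hy).1 with h3 | h3
    · exact absurd (h2.trans h3.symm) hne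
    · exact ⟨-1, by simp, by rw [h2, h3]; ring⟩
    · exact ⟨1, by simp, by rw [h2, h3]; ring⟩
    · exact absurd (h2.trans h3.symm) hne
  have h01 : ∀ n t, 0 ≤ Ψ n t ∧ Ψ n t ≤ 1 := by
    intro n t
    constructor
    · rw [← h0 n (min t (-h n)) (min_le_right _ _)]
      exact hmono n (min_le_left _ _)
    · rw [← h1 n (max t (h n)) (le_max_right _ _)]
      exact hmono n (le_max_left _ _)
  have hder : ∀ n x t, HasDerivAt (fun t => Ψ n (t - x)) (deriv (Ψ n) (t - x)) t := by
    intro n x t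
    exact ((hC n).differentiable (by norm_num) (t - x)).hasDerivAt.comp_sub_const t x
  have hdc : ∀ n x, Continuous fun t => deriv (Ψ n) (t - x) := by
    intro n x
    exact ((contDiff_one_iff_deriv.1 (hC n)).2).comp (continuous_id.sub continuous_const)
  refine ⟨fun n t => σ * k * (Ψ n (t - x) - Ψ n (t - y)), ?_, ?_, ?_, ?_⟩
  · intro n
    have := hC n
    exact contDiff_const.mul (((hC n).comp (contDiff_id.sub contDiff_const)).sub
      ((hC n).comp (contDiff_id.sub contDiff_const)))
  · have e1 : ∀ᶠ n in atTop, h n < min (x - α) (β - y) :=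
      hlim.eventually_lt_const (lt_min (by linarith) (by linarith))
    filter_upwards [e1] with n hn t ht
    obtain ⟨hn1, hn2⟩ := lt_min_iff.1 hn
    by_cases c : t < α
    · rw [h0 n _ (by linarith), h0 n _ (by linarith)]; ring
    · have : β < t := by
        by_contra h4
        exact ht ⟨by linarith, by linarith⟩
      rw [h1 n _ (by linarith), h1 n _ (by linarith)]; ring
  · intro n t
    rw [abs_mul, abs_mul, hσ, one_mul, abs_of_nonneg hk]
    have h5 := hmono n (show t - y ≤ t - x by linarith)
    have : |Ψ n (t - x) - Ψ n (t - y)| ≤ 1 := by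
      rw [abs_of_nonneg (by linarith)]
      linarith [(h01 n (t - x)).2, (h01 n (t - y)).1]
    exact mul_le_of_le_one_right hk this
  · have hl := (((hS x hx).2.sub (hS y hy).2).const_mul (σ * k))
    rw [show σ * k * (v x - v y) = k * (b - a) by rw [← hσv]; ring] at hl
    refine hl.congr fun n => ?_
    rw [← integral_sub (aux_int_mul T v _ hv (hdc n x)) (aux_int_mul T v _ hv (hdc n y)),
      ← integral_const_mul]
    congr 1
    funext t
    have : deriv (fun t => σ * k * (Ψ n (t - x) - Ψ n (t - y))) t
        = σ * k * (deriv (Ψ n) (t - x) - deriv (Ψ n) (t - y)) :=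
      (((hder n x t).sub (hder n y t)).const_mul (σ * k)).deriv
    rw [this]; ring

theorem aux_two_jumps (T a b : ℝ) (η v : ℝ → ℝ) (hab : a < b)
    (hpos : ∀ t ∈ Ioo (-T) T, 0 < η t) (hcont : ContinuousOn η (Ioo (-T) T))
    (hv : IntegrableOn v (Ioo (-T) T)) (Ψ : ℕ → ℝ → ℝ) (h : ℕ → ℝ)
    (hC : ∀ n, ContDiff ℝ 1 (Ψ n)) (hmono : ∀ n, Monotone (Ψ n))
    (hh : ∀ n, 0 < h n) (hlim : Tendsto h atTop (𝓝 0)) (h0 : ∀ n t, t ≤ - h n → Ψ n t = 0)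
    (h1 : ∀ n t, h n ≤ t → Ψ n t = 1)
    (S : Set ℝ) (hS : ∀ x ∈ S, (v x = a ∨ v x = b) ∧
      Tendsto (fun n => ∫ t in Ioo (-T) T, v t * deriv (Ψ n) (t - x)) atTop (𝓝 (v x)))
    (hbd : BddAbove (wTVvals T η v))
    (p p' : ℝ) (hp : p ∈ Ioo (-T) T) (hp' : p' ∈ Ioo (-T) T) (hpp : p < p')
    (hj : IsJump S v p) (hj' : IsJump S v p') :
    (b - a) * (η p + η p') ≤ wTV T η v := by
  have key : ∀ e > 0, e < η p → e < η p' →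
      (η p - e) * (b - a) + (η p' - e) * (b - a) ≤ wTV T η v := by
    intro e he he1 he2
    have near : ∀ p ∈ Ioo (-T) T, ∃ ε > 0, ∀ t, |t - p| < ε → η p - e < η t := by
      intro p hp
      have c := (hcont.continuousAt (isOpen_Ioo.mem_nhds hp)).eventually_const_lt
        (show η p - e < η p by linarith)
      obtain ⟨ε, hε, h2⟩ := Metric.eventually_nhds_iff.1 c
      exact ⟨ε, hε, fun t ht => h2 (by rwa [Real.dist_eq])⟩
    obtain ⟨ε₁, hε₁, hn₁⟩ := near p hp
    obtain ⟨ε₂, hε₂, hn₂⟩ := near p' hp'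
    obtain ⟨ε, hε, hεa, hεb, hεc, hεd, hεe⟩ : ∃ ε > 0, ε < ε₁ ∧ ε < ε₂ ∧ ε < (p' - p) / 2 ∧
        ε < p + T ∧ ε < T - p' := by
      obtain ⟨ε, hε, hε'⟩ := exists_between (show 0 < min ε₁ (min ε₂ (min ((p' - p) / 2)
        (min (p + T) (T - p')))) from lt_min hε₁ (lt_min hε₂ (lt_min (by linarith)
          (lt_min (by linarith [hp.1]) (by linarith [hp'.2])))))
      simp only [lt_min_iff] at hε'
      exact ⟨ε, hε, hε'.1, hε'.2.1, hε'.2.2.1, hε'.2.2.2.1, hε'.2.2.2.2⟩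
    obtain ⟨x₁, hx₁, y₁, hy₁, q1, q2, q3, q4⟩ := hj ε hε
    obtain ⟨x₂, hx₂, y₂, hy₂, r1, r2, r3, r4⟩ := hj' ε hε
    obtain ⟨Φ₁, A1, A2, A3, A4⟩ := aux_test T a b v hab hv Ψ h hC hmono hh hlim h0 h1 S hS
      x₁ y₁ (p - ε) (p + ε) (η p - e) hx₁ hy₁ q2 q4 q1 q3 (by linarith)
    obtain ⟨Φ₂, B1, B2, B3, B4⟩ := aux_test T a b v hab hv Ψ h hC hmono hh hlim h0 h1 S hS
      x₂ y₂ (p' - ε) (p' + ε) (η p' - e) hx₂ hy₂ r2 r4 r1 r3 (by linarith)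
    refine le_of_tendsto (A4.add B4) ?_
    filter_upwards [A2, B2] with n hA hB
    have dA : Continuous (deriv (Φ₁ n)) := (contDiff_one_iff_deriv.1 (A1 n)).2
    have dB : Continuous (deriv (Φ₂ n)) := (contDiff_one_iff_deriv.1 (B1 n)).2
    have hts : tsupport (fun t => Φ₁ n t + Φ₂ n t) ⊆ Icc (p - ε) (p' + ε) := by
      refine closure_minimal ?_ isClosed_Icc
      intro t ht
      by_contra hnot
      apply ht
      simp only
      rw [hA t, hB t, add_zero]
      · intro h'; exact hnot ⟨by linarith [h'.1], by linarith [h'.2]⟩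
      · intro h'; exact hnot ⟨by linarith [h'.1], by linarith [h'.2]⟩
    refine le_csSup hbd ⟨fun t => Φ₁ n t + Φ₂ n t, (A1 n).add (B1 n), ?_, ?_, ?_, ?_⟩
    · exact IsCompact.of_isClosed_subset isCompact_Icc (isClosed_tsupport _) hts
    · refine hts.trans fun t ht => ⟨by linarith [ht.1], by linarith [ht.2]⟩
    · intro t ht
      show |Φ₁ n t + Φ₂ n t| ≤ η t
      by_cases c1 : t ∈ Icc (p - ε) (p + ε)
      · have : t ∉ Icc (p' - ε) (p' + ε) := fun h' => by linarith [h'.1, c1.2]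
        rw [hB t this, add_zero]
        refine (A3 n t).trans (hn₁ t ?_).le
        rw [abs_lt]; exact ⟨by linarith [c1.1], by linarith [c1.2]⟩
      · rw [hA t c1, zero_add]
        by_cases c2 : t ∈ Icc (p' - ε) (p' + ε)
        · refine (B3 n t).trans (hn₂ t ?_).le
          rw [abs_lt]; exact ⟨by linarith [c2.1], by linarith [c2.2]⟩
        · rw [hB t c2, abs_zero]; exact (hpos t ht).le
    · rw [← integral_add (aux_int_mul T v _ hv dA) (aux_int_mul T v _ hv dB)]
      congr 1
      funext t
      have : deriv (fun t => Φ₁ n t + Φ₂ n t) t = deriv (Φ₁ n) t + deriv (Φ₂ n) t :=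
        deriv_fun_add ((A1 n).differentiable (by norm_num) t)
          ((B1 n).differentiable (by norm_num) t)
      rw [this]; ring
  have hlimit : Tendsto (fun e : ℝ => (η p - e) * (b - a) + (η p' - e) * (b - a)) (𝓝[>] 0)
      (𝓝 ((η p - 0) * (b - a) + (η p' - 0) * (b - a))) := by
    apply Tendsto.mono_left _ nhdsWithin_le_nhds
    apply Continuous.tendsto
    fun_prop
  have := le_of_tendsto hlimit (by
    have g1 : ∀ᶠ e in 𝓝[>] (0 : ℝ), e < η p :=
      nhdsWithin_le_nhds (eventually_lt_nhds (hpos p hp))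
    have g2 : ∀ᶠ e in 𝓝[>] (0 : ℝ), e < η p' :=
      nhdsWithin_le_nhds (eventually_lt_nhds (hpos p' hp'))
    filter_upwards [g1, g2, self_mem_nhdsWithin] with e e1 e2 e3
    exact key e e3 e1 e2)
  linarith

theorem aux_step_integral (T a b t₀ : ℝ) (ht₀ : t₀ ∈ Ioo (-T) T) (φ : ℝ → ℝ)
    (hφ : ContDiff ℝ 1 φ) (hs : tsupport φ ⊆ Ioo (-T) T) :
    ∫ t in Ioo (-T) T, stepAB a b t₀ t * deriv φ t = - (b - a) * φ t₀ := by
  have hT : -T ≤ T := by linarith [ht₀.1, ht₀.2]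
  have hdc : Continuous (deriv φ) := (contDiff_one_iff_deriv.1 hφ).2
  have hz : ∀ t, t ∉ Ioo (-T) T → φ t = 0 := fun t ht =>
    image_eq_zero_of_notMem_tsupport fun h => ht (hs h)
  have hftc : ∀ x y, ∫ t in x..y, deriv φ t = φ y - φ x := fun x y =>
    intervalIntegral.integral_deriv_eq_sub (fun t _ => hφ.differentiable (by norm_num) t)
      (hdc.intervalIntegrable x y)
  have e1 : EqOn (fun t => stepAB a b t₀ t * deriv φ t) (fun t => a * deriv φ t) (Ioo (-T) t₀) := by
    intro t ht
    simp [stepAB, ht.2.le]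
  have e2 : EqOn (fun t => stepAB a b t₀ t * deriv φ t) (fun t => b * deriv φ t) (Ioo t₀ T) := by
    intro t ht
    simp [stepAB, not_le.2 ht.1]
  have i1 : IntegrableOn (fun t => stepAB a b t₀ t * deriv φ t) (Ioc (-T) t₀) := by
    rw [integrableOn_Ioc_iff_integrableOn_Ioo, integrableOn_congr_fun e1 measurableSet_Ioo]
    exact ((continuous_const.mul hdc).integrableOn_Icc (a := -T) (b := t₀)).mono_set
      Ioo_subset_Icc_self
  have i2 : IntegrableOn (fun t => stepAB a b t₀ t * deriv φ t) (Ioo t₀ T) := by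
    rw [integrableOn_congr_fun e2 measurableSet_Ioo]
    exact ((continuous_const.mul hdc).integrableOn_Icc (a := t₀) (b := T)).mono_set
      Ioo_subset_Icc_self
  rw [← Ioc_union_Ioo_eq_Ioo ht₀.1.le ht₀.2, setIntegral_union _ measurableSet_Ioo i1 i2,
    integral_Ioc_eq_integral_Ioo, setIntegral_congr_fun measurableSet_Ioo e1,
    setIntegral_congr_fun measurableSet_Ioo e2, ← integral_Ioc_eq_integral_Ioo,
    ← integral_Ioc_eq_integral_Ioo, ← intervalIntegral.integral_of_le ht₀.1.le,
    ← intervalIntegral.integral_of_le ht₀.2.le, intervalIntegral.integral_const_mul,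
    intervalIntegral.integral_const_mul, hftc, hftc, hz (-T) (by simp), hz T (by simp)]
  · ring
  · rw [Set.disjoint_left]; intro t ht ht'; linarith [ht.2, ht'.1]

theorem aux_wTV_step (T a b t₀ : ℝ) (η : ℝ → ℝ) (ht₀ : t₀ ∈ Ioo (-T) T) (hab : a < b)
    (hpos : ∀ t ∈ Ioo (-T) T, 0 < η t) (hsm : ContDiffOn ℝ 1 η (Ioo (-T) T)) :
    wTV T η (stepAB a b t₀) = (b - a) * η t₀ := by
  apply le_antisymm
  · apply csSup_le
    · refine ⟨0, fun _ => 0, contDiff_const, ?_, ?_, ?_, ?_⟩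
      · exact HasCompactSupport.zero
      · simp [tsupport]
      · intro t ht; simpa using (hpos t ht).le
      · simp
    · rintro r ⟨φ, h1, h2, h3, h4, rfl⟩
      rw [aux_step_integral T a b t₀ ht₀ φ h1 h3]
      have := (abs_le.1 (h4 t₀ ht₀)).1
      nlinarith
  · obtain ⟨ε, hε, hε1, hε2⟩ : ∃ ε > 0, ε < t₀ + T ∧ ε < T - t₀ := by
      obtain ⟨ε, h1, h2⟩ := exists_between (show 0 < min (t₀ + T) (T - t₀) from
        lt_min (by linarith [ht₀.1]) (by linarith [ht₀.2]))
      exact ⟨ε, h1, (lt_min_iff.1 h2).1, (lt_min_iff.1 h2).2⟩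
    let χ : ContDiffBump t₀ := ⟨ε / 2, ε, by linarith, by linarith⟩
    have hsub : tsupport χ ⊆ Ioo (-T) T := by
      rw [χ.tsupport_eq]
      intro t ht
      rw [Metric.mem_closedBall, Real.dist_eq, abs_le] at ht
      have : χ.rOut = ε := rfl
      rw [this] at ht
      exact ⟨by linarith [ht.1], by linarith [ht.2]⟩
    have hts : tsupport (fun t => -(χ t * η t)) ⊆ tsupport χ := by
      apply closure_mono
      intro t ht h0
      apply ht
      simp [h0]
    have hCD : ContDiff ℝ 1 (fun t => -(χ t * η t)) := by
      rw [contDiff_iff_contDiffAt]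
      intro t
      by_cases c : t ∈ Ioo (-T) T
      · exact (χ.contDiff.contDiffAt.mul (hsm.contDiffAt (isOpen_Ioo.mem_nhds c))).neg
      · have : t ∉ tsupport (fun t => -(χ t * η t)) := fun h => c (hsub (hts h))
        rw [notMem_tsupport_iff_eventuallyEq] at this
        exact contDiffAt_const.congr_of_eventuallyEq this
    refine le_csSup ⟨(b - a) * η t₀, ?_⟩ ⟨fun t => -(χ t * η t), hCD, ?_, hts.trans hsub, ?_, ?_⟩
    · rintro r ⟨φ, h1, h2, h3, h4, rfl⟩
      rw [aux_step_integral T a b t₀ ht₀ φ h1 h3]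
      have := (abs_le.1 (h4 t₀ ht₀)).1
      nlinarith
    · exact IsCompact.of_isClosed_subset χ.hasCompactSupport (isClosed_tsupport _) hts
    · intro t ht
      rw [abs_neg, abs_mul, abs_of_nonneg χ.nonneg, abs_of_pos (hpos t ht)]
      exact mul_le_of_le_one_left (hpos t ht).le χ.le_one
    · rw [aux_step_integral T a b t₀ ht₀ _ hCD (hts.trans hsub)]
      have : χ t₀ = 1 := χ.one_of_mem_closedBall (Metric.mem_closedBall_self χ.rIn_pos.le)
      rw [this]; ring

theorem aux_core (T a b t₀ r κ L c₁ ρ : ℝ) (η v : ℝ → ℝ) (n₁ n₂ : ℕ) (d₁ d₂ d₃ d₄ tstar : ℝ)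
    (hab : a < b) (hL : 0 ≤ L) (hd₁ : 0 < d₁) (hd₂ : 0 < d₂) (hd₃ : 0 < d₃) (hd₄ : 0 < d₄)
    (hρ₁ : d₂ / d₁ ≤ ρ) (hρ₂ : d₄ / d₃ ≤ ρ)
    (tail₁ : ∀ t ∈ Set.Ioc (-T) (-T + tstar),
      d₁ * (t + T) ^ (n₁ - 1) ≤ η t ∧ η t ≤ d₂ * (t + T) ^ (n₁ - 1))
    (tail₂ : ∀ t ∈ Set.Ico (T - tstar) T,
      d₃ * (T - t) ^ (n₂ - 1) ≤ η t ∧ η t ≤ d₄ * (T - t) ^ (n₂ - 1))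
    (hκ : 0 < κ) (hκt : κ < tstar) (hκ1 : -T + κ ≤ t₀ - r) (hκ2 : t₀ + r ≤ T - κ)
    (hc₁ : ∀ t ∈ Icc (-T + κ) (T - κ), c₁ ≤ η t) (hLr : L * r < c₁)
    (hLip : ∀ x, |x - t₀| ≤ r → η t₀ - η x ≤ L * |x - t₀|)
    (S : Set ℝ) (hSI : S ⊆ Ioo (-T) T)
    (hS : ∀ x y, -T ≤ x → y ≤ T → x < y → ∃ z ∈ S, x < z ∧ z < y)
    (hSv : ∀ z ∈ S, v z = a ∨ v z = b)
    (hJ : ∀ p p', p ∈ Ioo (-T) T → p' ∈ Ioo (-T) T → p < p' → IsJump S v p → IsJump S v p' →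
      η p + η p' ≤ η t₀)
    (x₁ x₂ y₁ y₂ : ℝ) (hx₁ : x₁ ∈ S) (hx₂ : x₂ ∈ S) (hy₁ : y₁ ∈ S) (hy₂ : y₂ ∈ S)
    (h1 : t₀ - r ≤ x₁) (h2 : x₁ < x₂) (h3 : x₂ < t₀) (h4 : t₀ < y₁) (h5 : y₁ < y₂)
    (h6 : y₂ ≤ t₀ + r) (vx₁ : v x₁ = a) (vx₂ : v x₂ = a) (vy₁ : v y₁ = b) (vy₂ : v y₂ = b) :
    ∃ xs, |xs - t₀| ≤ r ∧ ∀ z ∈ S, z ≠ xs → v z = stepAB a b xs z ∨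
      ((z ∈ Ioo (-T) (-T + κ) ∨ z ∈ Ioo (T - κ) T) ∧ η z ≤ ρ * (L * |xs - t₀|)) := by
  obtain ⟨xs, g1, g2, g3⟩ := aux_exists_jump S v (-T) T hS x₂ y₁ hx₂ hy₁ (by linarith)
    (hSI hx₂).1.le (hSI hy₁).2.le (by rw [vx₂, vy₁]; exact hab.ne)
  have hxsr : |xs - t₀| ≤ r := by rw [abs_le]; constructor <;> linarith
  have hxsI : xs ∈ Ioo (-T) T := ⟨by linarith, by linarith⟩
  have hother : ∀ p ∈ Ioo (-T) T, p ≠ xs → IsJump S v p → η p ≤ L * |xs - t₀| := by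
    intro p hp hne hj
    have := hLip xs hxsr
    rcases lt_or_gt_of_ne hne with h | h
    · linarith [hJ p xs hp hxsI h hj g3]
    · linarith [hJ xs p hxsI hp h g3 hj]
  have hout : ∀ p ∈ Ioo (-T) T, p ≠ xs → IsJump S v p → p < -T + κ ∨ T - κ < p := by
    intro p hp hne hj
    by_contra hcon
    rw [not_or, not_lt, not_lt] at hcon
    have e1 := hc₁ p hcon
    have e2 := hother p hp hne hj
    have e3 := mul_le_mul_of_nonneg_left hxsr hL
    linarith
  refine ⟨xs, hxsr, fun z hz hzne => ?_⟩
  have hzI := hSI hz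
  rcases lt_or_gt_of_ne hzne with h | h
  · have hst : stepAB a b xs z = a := by simp [stepAB, h.le]
    rw [hst]
    rcases hSv z hz with hv | hv
    · exact Or.inl hv
    right
    rcases lt_trichotomy z x₁ with c | c | c
    · obtain ⟨p, q1, q2, q3⟩ := aux_exists_jump S v (-T) T hS z x₁ hz hx₁ c
        hzI.1.le (hSI hx₁).2.le (by rw [vx₁, hv]; exact hab.ne')
      have hpI : p ∈ Ioo (-T) T := ⟨by linarith [hzI.1], by linarith⟩
      have hpne : p ≠ xs := by intro he; linarith
      have hpl : p < -T + κ := by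
        rcases hout p hpI hpne q3 with h' | h'
        · exact h'
        · linarith
      refine ⟨Or.inl ⟨hzI.1, by linarith⟩, ?_⟩
      have w1 := (tail₁ z ⟨hzI.1, by linarith⟩).2
      have w2 := (tail₁ p ⟨hpI.1, by linarith⟩).1
      have w3 : (z + T) ^ (n₁ - 1) ≤ (p + T) ^ (n₁ - 1) :=
        pow_le_pow_left₀ (by linarith [hzI.1]) (by linarith) _
      have w4 := hother p hpI hpne q3
      calc η z ≤ d₂ * (p + T) ^ (n₁ - 1) := w1.trans (mul_le_mul_of_nonneg_left w3 hd₂.le)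
        _ = d₂ / d₁ * (d₁ * (p + T) ^ (n₁ - 1)) := by field_simp
        _ ≤ d₂ / d₁ * (L * |xs - t₀|) :=
            mul_le_mul_of_nonneg_left (w2.trans w4) (by positivity)
        _ ≤ ρ * (L * |xs - t₀|) := mul_le_mul_of_nonneg_right hρ₁ (by positivity)
    · rw [c, vx₁] at hv; exact absurd hv hab.ne
    · exfalso
      obtain ⟨p, q1, q2, q3⟩ := aux_exists_jump S v (-T) T hS x₁ z hx₁ hz c
        (hSI hx₁).1.le hzI.2.le (by rw [vx₁, hv]; exact hab.ne)
      rcases hout p ⟨by linarith, by linarith⟩ (by intro he; linarith) q3 with h' | h'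
      · linarith
      · linarith
  · have hst : stepAB a b xs z = b := by simp [stepAB, not_le.2 h]
    rw [hst]
    rcases hSv z hz with hv | hv
    swap
    · exact Or.inl hv
    right
    rcases lt_trichotomy z y₂ with c | c | c
    · exfalso
      obtain ⟨p, q1, q2, q3⟩ := aux_exists_jump S v (-T) T hS z y₂ hz hy₂ c
        hzI.1.le (hSI hy₂).2.le (by rw [vy₂, hv]; exact hab.ne)
      rcases hout p ⟨by linarith, by linarith⟩ (by intro he; linarith) q3 with h' | h'
      · linarith
      · linarith
    · rw [c, vy₂] at hv; exact absurd hv hab.ne'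
    · obtain ⟨p, q1, q2, q3⟩ := aux_exists_jump S v (-T) T hS y₂ z hy₂ hz c
        (hSI hy₂).1.le hzI.2.le (by rw [vy₂, hv]; exact hab.ne')
      have hpI : p ∈ Ioo (-T) T := ⟨by linarith, by linarith [hzI.2]⟩
      have hpne : p ≠ xs := by intro he; linarith
      have hpl : T - κ < p := by
        rcases hout p hpI hpne q3 with h' | h'
        · linarith
        · exact h'
      refine ⟨Or.inr ⟨by linarith, hzI.2⟩, ?_⟩
      have w1 := (tail₂ z ⟨by linarith, hzI.2⟩).2
      have w2 := (tail₂ p ⟨by linarith, hpI.2⟩).1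
      have w3 : (T - z) ^ (n₂ - 1) ≤ (T - p) ^ (n₂ - 1) :=
        pow_le_pow_left₀ (by linarith [hzI.2]) (by linarith) _
      have w4 := hother p hpI hpne q3
      calc η z ≤ d₄ * (T - p) ^ (n₂ - 1) := w1.trans (mul_le_mul_of_nonneg_left w3 hd₄.le)
        _ = d₄ / d₃ * (d₃ * (T - p) ^ (n₂ - 1)) := by field_simp
        _ ≤ d₄ / d₃ * (L * |xs - t₀|) :=
            mul_le_mul_of_nonneg_left (w2.trans w4) (by positivity)
        _ ≤ ρ * (L * |xs - t₀|) := mul_le_mul_of_nonneg_right hρ₂ (by positivity)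

theorem aux_ae_exists (S : Set ℝ) (T : ℝ) (hS : ∀ᵐ t ∂(volume.restrict (Ioo (-T) T)), t ∈ S)
    (x y : ℝ) (hx : -T ≤ x) (hy : y ≤ T) (hxy : x < y) : ∃ z ∈ S, x < z ∧ z < y := by
  have h1 : ∀ᵐ t ∂(volume.restrict (Ioo x y)), t ∈ S :=
    ae_restrict_of_ae_restrict_of_subset (Ioo_subset_Ioo hx hy) hS
  have h2 : ∀ᵐ t ∂(volume.restrict (Ioo x y)), t ∈ Ioo x y := ae_restrict_mem measurableSet_Ioo
  have : NeBot (ae (volume.restrict (Ioo x y))) := by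
    rw [ae_neBot, Ne, Measure.restrict_eq_zero, Real.volume_Ioo]
    simp [hxy]
  obtain ⟨z, hz1, hz2⟩ := (h1.and h2).exists
  exact ⟨z, hz1, hz2.1, hz2.2⟩

theorem aux_step_meas (a b t₀ : ℝ) : Measurable (stepAB a b t₀) :=
  Measurable.ite measurableSet_Iic measurable_const measurable_const

theorem aux_int_bdd (T C : ℝ) (η w : ℝ → ℝ) (hη : IntegrableOn η (Ioo (-T) T))
    (hw : AEStronglyMeasurable w (volume.restrict (Ioo (-T) T)))
    (hb : ∀ᵐ t ∂(volume.restrict (Ioo (-T) T)), |w t| ≤ C) :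
    IntegrableOn (fun t => w t * η t) (Ioo (-T) T) :=
  Integrable.bdd_mul hη hw hb

theorem aux_step_bdd (a b t₀ t : ℝ) : |stepAB a b t₀ t| ≤ |a| + |b| := by
  unfold stepAB
  split_ifs
  · linarith [abs_nonneg b]
  · linarith [abs_nonneg a]

theorem aux_ind_int (T α β B : ℝ) (hα : -T ≤ α) (hβ : β ≤ T) (h : α ≤ β) :
    ∫ t in Ioo (-T) T, (Ioo α β).indicator (fun _ => B) t = (β - α) * B ∧
    IntegrableOn ((Ioo α β).indicator (fun _ => B)) (Ioo (-T) T) := by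
  constructor
  · rw [setIntegral_indicator measurableSet_Ioo,
      inter_eq_self_of_subset_right (Ioo_subset_Ioo hα hβ), setIntegral_const]
    simp [h]
  · exact (integrable_const B).indicator measurableSet_Ioo

theorem aux_step_diff (T a b c₀ s t : ℝ) (η : ℝ → ℝ) (hab : a < b) (hT : s ≤ t)
    (hη : IntegrableOn η (Ioo (-T) T)) (hpos : ∀ t ∈ Ioo (-T) T, 0 < η t)
    (hs : -T ≤ s) (ht : t ≤ T) (hc : ∀ x ∈ Ioo s t, c₀ ≤ η x) :
    (t - s) * ((b - a) * c₀) ≤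
      (∫ x in Ioo (-T) T, stepAB a b s x * η x) - ∫ x in Ioo (-T) T, stepAB a b t x * η x := by
  have i : ∀ s, IntegrableOn (fun x => stepAB a b s x * η x) (Ioo (-T) T) := fun s =>
    aux_int_bdd T (|a| + |b|) η _ hη (aux_step_meas a b s).aestronglyMeasurable
      (ae_of_all _ (aux_step_bdd a b s))
  obtain ⟨e1, e2⟩ := aux_ind_int T s t ((b - a) * c₀) hs ht hT
  rw [← integral_sub (i s) (i t), ← e1]
  refine setIntegral_mono_on e2 ((i s).sub (i t)) measurableSet_Ioo fun x hx => ?_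
  have hp := hpos x hx
  by_cases h : x ∈ Ioo s t
  · rw [indicator_of_mem h]
    have := hc x h
    simp only [stepAB, not_le.2 h.1, h.2.le, if_true, if_false]
    nlinarith
  · rw [indicator_of_notMem h]
    have : stepAB a b t x ≤ stepAB a b s x := by
      unfold stepAB
      split_ifs with h1 h2 h2
      · rfl
      · exact hab.le
      · exact absurd (h2.trans hT) h1
      · rfl
    nlinarith

/-- **The single-interface configuration is an isolated local minimizer of `G⁽¹⁾`**
(Theorem 4.5). There is `δ > 0` such that no `v₁` in the class `𝒞` with
`0 < ‖v₁ - v₀‖_{L¹_η} ≤ δ` satisfies `G⁽¹⁾(v₁) ≤ G⁽¹⁾(v₀) = 2 c_W η(t₀)`. -/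
theorem step_isolated_local_minimizer
    (W : ℝ → ℝ) (a b c q l : ℝ) (hW : DoubleWell W a b c q l)
    (T : ℝ) (hT : 0 < T)
    (η : ℝ → ℝ) (β : ℝ) (n₁ n₂ : ℕ) (d₁ d₂ d₃ d₄ d₅ tstar : ℝ)
    (hη : GoodWeight T η β n₁ n₂ d₁ d₂ d₃ d₄ d₅ tstar)
    (m : ℝ)
    (hm₁ : a * (∫ t in Set.Ioo (-T) T, η t) < m)
    (hm₂ : m < b * ∫ t in Set.Ioo (-T) T, η t)
    (cW : ℝ) (hcW : cW = ∫ s in a..b, Real.sqrt (W s))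
    (t₀ : ℝ) (ht₀ : t₀ ∈ Set.Ioo (-T) T)
    (hmass₀ : massEq T η m (stepAB a b t₀)) :
    -- `G⁽¹⁾(v₀) = 2 c_W η(t₀)`
    (2 * cW / (b - a)) * wTV T η (stepAB a b t₀) = 2 * cW * η t₀ ∧
    -- isolated `δ`-local minimality
    ∃ δ > 0, ∀ v₁ : ℝ → ℝ, memC T η a b m v₁ →
      0 < dist1 T η v₁ (stepAB a b t₀) → dist1 T η v₁ (stepAB a b t₀) ≤ δ →
      ¬ ((2 * cW / (b - a)) * wTV T η v₁ ≤ (2 * cW / (b - a)) * wTV T η (stepAB a b t₀)) := by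
  have hab := hW.lt_ab
  have hcWpos : 0 < cW := hcW ▸ aux_cW_pos W a b c q l hW
  have hTV := aux_wTV_step T a b t₀ η ht₀ hab hη.pos hη.smooth
  have hba : 0 < b - a := by linarith
  refine ⟨by rw [hTV]; field_simp, ?_⟩
  have hcont : ContinuousOn η (Ioo (-T) T) := hη.smooth.continuousOn
  -- constants
  obtain ⟨r₀, hr₀, hr₀1, hr₀2⟩ : ∃ r₀ > 0, r₀ < t₀ + T ∧ r₀ < T - t₀ := by
    obtain ⟨ε, h1, h2⟩ := exists_between (show 0 < min (t₀ + T) (T - t₀) from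
      lt_min (by linarith [ht₀.1]) (by linarith [ht₀.2]))
    exact ⟨ε, h1, (lt_min_iff.1 h2).1, (lt_min_iff.1 h2).2⟩
  have hminpos : ∀ α β, -T < α → β < T → α ≤ β → ∃ c > 0, ∀ t ∈ Icc α β, c ≤ η t := by
    intro α β h1 h2 h3
    have hsub : Icc α β ⊆ Ioo (-T) T := fun t ht => ⟨by linarith [ht.1], by linarith [ht.2]⟩
    obtain ⟨x, hx, hmin⟩ := isCompact_Icc.exists_isMinOn (nonempty_Icc.2 h3) (hcont.mono hsub)
    exact ⟨η x, hη.pos x (hsub hx), fun t ht => hmin ht⟩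
  obtain ⟨c₀, hc₀, hc₀'⟩ := hminpos (t₀ - r₀) (t₀ + r₀) (by linarith) (by linarith) (by linarith)
  have hsub₀ : Icc (t₀ - r₀) (t₀ + r₀) ⊆ Ioo (-T) T := fun t ht =>
    ⟨by linarith [ht.1], by linarith [ht.2]⟩
  obtain ⟨L, hL, hLip⟩ : ∃ L > 0, ∀ x, |x - t₀| ≤ r₀ → η t₀ - η x ≤ L * |x - t₀| := by
    have hdc : ContinuousOn (deriv η) (Ioo (-T) T) :=
      hη.smooth.continuousOn_deriv_of_isOpen isOpen_Ioo (by norm_num)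
    obtain ⟨C, hC⟩ := isCompact_Icc.exists_bound_of_continuousOn (hdc.mono hsub₀)
    refine ⟨max C 1, by positivity, fun x hx => ?_⟩
    rw [abs_le] at hx
    have := (convex_Icc (t₀ - r₀) (t₀ + r₀)).norm_image_sub_le_of_norm_deriv_le (f := η)
      (C := max C 1) (x := x) (y := t₀)
      (fun t ht => (hη.smooth.contDiffAt (isOpen_Ioo.mem_nhds (hsub₀ ht))).differentiableAt
        (by norm_num))
      (fun t ht => (hC t ht).trans (le_max_left _ _))
      ⟨by linarith, by linarith⟩ ⟨by linarith, by linarith⟩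
    rw [Real.norm_eq_abs, Real.norm_eq_abs, abs_sub_comm t₀ x] at this
    exact (le_abs_self _).trans this
  set ρ := d₂ / d₁ + d₄ / d₃ with hρ
  have hp1 : 0 < d₂ / d₁ := div_pos hη.d₂_pos hη.d₁_pos
  have hp2 : 0 < d₄ / d₃ := div_pos hη.d₄_pos hη.d₃_pos
  have hρpos : 0 < ρ := by linarith
  obtain ⟨κ, hκ, hκ1, hκ2, hκ3, hκ4⟩ : ∃ κ > 0, κ < tstar ∧ κ < t₀ + T - r₀ ∧ κ < T - t₀ - r₀ ∧
      2 * κ * (ρ * L) < c₀ := by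
    obtain ⟨κ, h1, h2⟩ := exists_between (show 0 < min tstar (min (t₀ + T - r₀)
      (min (T - t₀ - r₀) (c₀ / (2 * (ρ * L))))) from
      lt_min hη.tstar_mem.1 (lt_min (by linarith) (lt_min (by linarith) (by positivity))))
    simp only [lt_min_iff] at h2
    refine ⟨κ, h1, h2.1, h2.2.1, h2.2.2.1, ?_⟩
    have := h2.2.2.2
    rw [lt_div_iff₀ (by positivity)] at this
    linarith
  obtain ⟨c₁, hc₁, hc₁'⟩ := hminpos (-T + κ) (T - κ) (by linarith) (by linarith) (by linarith)
  obtain ⟨r, hr, hr1, hr2⟩ : ∃ r > 0, r < r₀ ∧ L * r < c₁ := by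
    obtain ⟨r, h1, h2⟩ := exists_between (show 0 < min r₀ (c₁ / L) from
      lt_min hr₀ (by positivity))
    rw [lt_min_iff, lt_div_iff₀ hL] at h2
    exact ⟨r, h1, h2.1, by linarith⟩
  refine ⟨r / 4 * ((b - a) * c₀), by positivity, ?_⟩
  intro v hmem hdpos hdle hle
  obtain ⟨hval, hbdd, hmass⟩ := hmem
  have hwTV : wTV T η v ≤ (b - a) * η t₀ := by
    rw [hTV] at hle
    exact le_of_mul_le_mul_left hle (by positivity)
  -- measurability of `v`
  have hwint : IntegrableOn (fun t => |v t - stepAB a b t₀ t| * η t) (Ioo (-T) T) := by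
    by_contra hcon
    have : dist1 T η v (stepAB a b t₀) = 0 := integral_undef hcon
    linarith
  have hIae : ∀ᵐ t ∂(volume.restrict (Ioo (-T) T)), t ∈ Ioo (-T) T :=
    ae_restrict_mem measurableSet_Ioo
  have hvm : AEStronglyMeasurable v (volume.restrict (Ioo (-T) T)) := by
    have hm1 : AEMeasurable (fun t => stepAB a b t₀ t +
        (|v t - stepAB a b t₀ t| * η t) * (η t)⁻¹ * stepAB 1 (-1) t₀ t)
        (volume.restrict (Ioo (-T) T)) :=
      (aux_step_meas a b t₀).aemeasurable.add
        ((hwint.aestronglyMeasurable.aemeasurable.mul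
          hη.integrable.aestronglyMeasurable.aemeasurable.inv).mul
            (aux_step_meas 1 (-1) t₀).aemeasurable)
    refine (hm1.congr ?_).aestronglyMeasurable
    filter_upwards [hval, hIae] with t h1 h2
    have h3 := hη.pos t h2
    rw [mul_assoc (|v t - stepAB a b t₀ t|), mul_inv_cancel₀ h3.ne', mul_one]
    unfold stepAB
    split_ifs with h4
    · rw [abs_of_nonneg]
      · ring
      · rcases h1 with h1 | h1 <;> rw [h1] <;> linarith
    · rw [abs_of_nonpos]
      · ring
      · rcases h1 with h1 | h1 <;> rw [h1] <;> linarith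
  have hvb : ∀ᵐ t ∂(volume.restrict (Ioo (-T) T)), |v t| ≤ |a| + |b| := by
    filter_upwards [hval] with t h1
    rcases h1 with h1 | h1 <;> rw [h1]
    · linarith [abs_nonneg b]
    · linarith [abs_nonneg a]
  have hvint : IntegrableOn v (Ioo (-T) T) := Integrable.of_bound hvm _ hvb
  -- mollification and the good set
  obtain ⟨Ψ, h, hC, hmono, hh, hlim, h0, h1, hae⟩ := aux_mollifier ((Ioo (-T) T).indicator v)
    ((integrable_indicator_iff measurableSet_Ioo).2 hvint).locallyIntegrable
  set S : Set ℝ := {x | x ∈ Ioo (-T) T ∧ (v x = a ∨ v x = b) ∧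
      Tendsto (fun n => ∫ t in Ioo (-T) T, v t * deriv (Ψ n) (t - x)) atTop (𝓝 (v x))} with hSdef
  have hSae : ∀ᵐ t ∂(volume.restrict (Ioo (-T) T)), t ∈ S := by
    filter_upwards [hval, hIae, ae_restrict_of_ae hae] with x e1 e2 e3
    refine ⟨e2, e1, ?_⟩
    rw [indicator_of_mem e2] at e3
    refine e3.congr fun n => ?_
    rw [← integral_indicator measurableSet_Ioo]
    congr 1
    funext t
    by_cases ht : t ∈ Ioo (-T) T
    · rw [indicator_of_mem ht, indicator_of_mem ht]
    · rw [indicator_of_notMem ht, indicator_of_notMem ht, zero_mul]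
  have hSI : S ⊆ Ioo (-T) T := fun x hx => hx.1
  have hSd := aux_ae_exists S T hSae
  have hJ : ∀ p p', p ∈ Ioo (-T) T → p' ∈ Ioo (-T) T → p < p' → IsJump S v p → IsJump S v p' →
      η p + η p' ≤ η t₀ := by
    intro p p' hp hp' hpp hj hj'
    have := aux_two_jumps T a b η v hab hη.pos hcont hvint Ψ h hC hmono hh hlim h0 h1 S
      (fun x hx => hx.2) hbdd p p' hp hp' hpp hj hj'
    exact le_of_mul_le_mul_left (this.trans hwTV) hba
  -- picking points
  have hpick : ∀ α β, t₀ - r ≤ α → β ≤ t₀ + r → β - α = r / 2 →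
      ∃ z ∈ S, α < z ∧ z < β ∧ v z = stepAB a b t₀ z := by
    intro α β hα hβ hαβ
    by_contra hcon
    push Not at hcon
    obtain ⟨e1, e2⟩ := aux_ind_int T α β ((b - a) * c₀) (by linarith) (by linarith) (by linarith)
    have : (β - α) * ((b - a) * c₀) ≤ dist1 T η v (stepAB a b t₀) := by
      rw [← e1]
      refine integral_mono_ae e2 hwint ?_
      filter_upwards [hSae] with z hz
      have hpz := hη.pos z (hSI hz)
      by_cases hzz : z ∈ Ioo α β
      · rw [indicator_of_mem hzz]
        have e3 := hcon z hz hzz.1 hzz.2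
        have e4 : |v z - stepAB a b t₀ z| = b - a := by
          unfold stepAB at e3 ⊢
          rcases hz.2.1 with e5 | e5 <;> rw [e5] at e3 ⊢ <;> split_ifs at e3 ⊢ with e6
          · exact absurd rfl e3
          · rw [abs_of_nonpos (by linarith)]; ring
          · rw [abs_of_pos (by linarith)]
          · exact absurd rfl e3
        rw [e4]
        exact mul_le_mul_of_nonneg_left
          (hc₀' z ⟨by linarith [hzz.1], by linarith [hzz.2]⟩) hba.le
      · rw [indicator_of_notMem hzz]
        positivity
    rw [hαβ] at this
    have : 0 < r * ((b - a) * c₀) := by positivity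
    linarith
  obtain ⟨x₁, hx₁, x₁a, x₁b, x₁v⟩ := hpick (t₀ - r) (t₀ - r / 2) le_rfl (by linarith) (by ring)
  obtain ⟨x₂, hx₂, x₂a, x₂b, x₂v⟩ := hpick (t₀ - r / 2) t₀ (by linarith) (by linarith) (by ring)
  obtain ⟨y₁, hy₁, y₁a, y₁b, y₁v⟩ := hpick t₀ (t₀ + r / 2) (by linarith) (by linarith) (by ring)
  obtain ⟨y₂, hy₂, y₂a, y₂b, y₂v⟩ := hpick (t₀ + r / 2) (t₀ + r) (by linarith) le_rfl (by ring)
  have sta : ∀ z, z < t₀ → stepAB a b t₀ z = a := fun z hz => by simp [stepAB, hz.le]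
  have stb : ∀ z, t₀ < z → stepAB a b t₀ z = b := fun z hz => by simp [stepAB, not_le.2 hz]
  rw [sta _ (by linarith)] at x₁v x₂v
  rw [stb _ (by linarith)] at y₁v y₂v
  obtain ⟨xs, hxs, hbad⟩ := aux_core T a b t₀ r κ L c₁ ρ η v n₁ n₂ d₁ d₂ d₃ d₄ tstar hab hL.le
    hη.d₁_pos hη.d₂_pos hη.d₃_pos hη.d₄_pos (by linarith) (by linarith) hη.tail₁ hη.tail₂
    hκ hκ1 (by linarith) (by linarith) hc₁' hr2 (fun x hx => hLip x (by linarith)) S hSI hSd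
    (fun z hz => hz.2.1) hJ x₁ x₂ y₁ y₂ hx₁ hx₂ hy₁ hy₂ (by linarith) (by linarith) (by linarith)
    (by linarith) (by linarith) (by linarith) x₁v x₂v y₁v y₂v
  rw [abs_le] at hxs
  -- the defect
  set B := (b - a) * (ρ * (L * |xs - t₀|)) with hB
  have hB0 : 0 ≤ B := by positivity
  have hne : ∀ᵐ t ∂(volume.restrict (Ioo (-T) T)), t ≠ xs :=
    ae_restrict_of_ae (Measure.ae_ne volume xs)
  have hpt : ∀ᵐ t ∂(volume.restrict (Ioo (-T) T)),
      ‖v t * η t - stepAB a b xs t * η t‖ ≤ (Ioo (-T) (-T + κ)).indicator (fun _ => B) t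
        + (Ioo (T - κ) T).indicator (fun _ => B) t := by
    filter_upwards [hSae, hne] with z hz hzne
    have i1 : 0 ≤ (Ioo (-T) (-T + κ)).indicator (fun _ => B) z :=
      indicator_nonneg (fun _ _ => hB0) z
    have i2 : 0 ≤ (Ioo (T - κ) T).indicator (fun _ => B) z :=
      indicator_nonneg (fun _ _ => hB0) z
    have hpz := hη.pos z (hSI hz)
    rcases hbad z hz hzne with e | ⟨e1, e2⟩
    · rw [e, sub_self, norm_zero]; linarith
    · have e3 : ‖v z * η z - stepAB a b xs z * η z‖ ≤ B := by
        rw [← sub_mul, Real.norm_eq_abs, abs_mul, abs_of_pos hpz]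
        have e4 : |v z - stepAB a b xs z| ≤ b - a := by
          rw [abs_le]
          unfold stepAB
          rcases hz.2.1 with e5 | e5 <;> rw [e5] <;> split_ifs <;> constructor <;> linarith
        exact mul_le_mul e4 e2 hpz.le hba.le
      rcases e1 with e1 | e1
      · rw [indicator_of_mem e1]; linarith
      · rw [indicator_of_mem e1]; linarith
  obtain ⟨k1, k2⟩ := aux_ind_int T (-T) (-T + κ) B le_rfl (by linarith) (by linarith)
  obtain ⟨k3, k4⟩ := aux_ind_int T (T - κ) T B (by linarith) le_rfl (by linarith)
  have hi1 : IntegrableOn (fun t => v t * η t) (Ioo (-T) T) :=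
    aux_int_bdd T _ η v hη.integrable hvm hvb
  have hi2 : ∀ s, IntegrableOn (fun x => stepAB a b s x * η x) (Ioo (-T) T) := fun s =>
    aux_int_bdd T (|a| + |b|) η _ hη.integrable (aux_step_meas a b s).aestronglyMeasurable
      (ae_of_all _ (aux_step_bdd a b s))
  have hup := norm_integral_le_of_norm_le (k2.add k4) hpt
  have hsum : ∫ t in Ioo (-T) T, ((Ioo (-T) (-T + κ)).indicator (fun _ => B) t
        + (Ioo (T - κ) T).indicator (fun _ => B) t) = 2 * κ * B := by
    rw [integral_add k2 k4, k1, k3]; ring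
  have hmm : (∫ t in Ioo (-T) T, v t * η t) = ∫ t in Ioo (-T) T, stepAB a b t₀ t * η t :=
    hmass.trans hmass₀.symm
  simp only [Pi.add_apply] at hup
  rw [hsum, integral_sub hi1 (hi2 xs), hmm, Real.norm_eq_abs] at hup
  have hlow : |xs - t₀| * ((b - a) * c₀) ≤
      |(∫ t in Ioo (-T) T, stepAB a b t₀ t * η t) - ∫ t in Ioo (-T) T, stepAB a b xs t * η t| := by
    rcases le_total t₀ xs with hc | hc
    · rw [abs_of_nonneg (show 0 ≤ xs - t₀ by linarith)]
      exact (aux_step_diff T a b c₀ t₀ xs η hab hc hη.integrable hη.pos (by linarith)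
        (by linarith) (fun x hx => hc₀' x ⟨by linarith [hx.1], by linarith [hx.2]⟩)).trans
        (le_abs_self _)
    · rw [abs_sub_comm xs t₀, abs_of_nonneg (show 0 ≤ t₀ - xs by linarith), abs_sub_comm]
      exact (aux_step_diff T a b c₀ xs t₀ η hab hc hη.integrable hη.pos (by linarith)
        (by linarith) (fun x hx => hc₀' x ⟨by linarith [hx.1], by linarith [hx.2]⟩)).trans
        (le_abs_self _)
  have hfin : |xs - t₀| * (b - a) * (c₀ - 2 * κ * (ρ * L)) ≤ 0 := by
    have := hlow.trans hup
    rw [hB] at this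
    linarith
  have hzero : |xs - t₀| = 0 := by
    by_contra hcon
    have : 0 < |xs - t₀| := lt_of_le_of_ne (abs_nonneg _) (Ne.symm hcon)
    have h4 : 0 < c₀ - 2 * κ * (ρ * L) := by linarith
    have : 0 < |xs - t₀| * (b - a) * (c₀ - 2 * κ * (ρ * L)) := by positivity
    linarith
  have hxt : xs = t₀ := by
    have := abs_eq_zero.1 hzero
    linarith
  have hd0 : dist1 T η v (stepAB a b t₀) = 0 := by
    refine integral_eq_zero_of_ae ?_
    filter_upwards [hSae, hne] with z hz hzne
    have hpz := hη.pos z (hSI hz)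
    rcases hbad z hz hzne with e | ⟨e1, e2⟩
    · rw [e, hxt]; simp
    · rw [hzero] at e2; linarith
  linarith
end

section
/- Exponential barrier estimate: fix rho in (0, (1/2) min{c - a, b - c}) and exponents theta_1, theta_2 with 1/n_i < theta_i < 1/(n_i - 1) (interpreted as theta_i > 1/n_i when n_i = 1), and set c(n_i) := 0 if n_i = 1 and c(n_i) := 1 otherwise. Then there exist mu > 0 (depending on rho and W but not on eps) and eps_0 > 0 such that for every eps in (0, eps_0) and every maximal interval I_eps contained in { t in [ -T + c(n_1) eps^{theta_1}, T - c(n_2) eps^{theta_2} ] : v_eps(t) >= c + rho }, one has b_eps - v_eps(t) <= 2 ( b_eps - c - rho ) exp( - mu d(t, complement of I_eps) / eps ) for all t in I_eps; analogously, on every maximal interval I_eps contained in { t in [ -T + c(n_1) eps^{theta_1}, T - c(n_2) eps^{theta_2} ] : v_eps(t) <= c - rho }, one has v_eps(t) - a_eps <= 2 ( c - rho - a_eps ) exp( - mu d(t, complement of I_eps) / eps ) for all t in I_eps. Here d(t, E) denotes the distance from t to the set E. -/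
open MeasureTheory Set Filter Topology Asymptotics
open scoped ENNReal Classical

/-- `J` is a maximal (order-connected) subinterval of `A`. -/
def MaxSubInterval (A J : Set ℝ) : Prop :=
  J.Nonempty ∧ J.OrdConnected ∧ J ⊆ A ∧
  ∀ J' : Set ℝ, J ⊆ J' → J'.OrdConnected → J' ⊆ A → J' = J

/-- The constant `c(nᵢ)`: `0` if `nᵢ = 1` and `1` otherwise. -/
noncomputable def cnn (k : ℕ) : ℝ := if k = 1 then 0 else 1

theorem local_max_aux {g h : ℝ → ℝ} {s₀ G x y : ℝ} (hg : HasDerivAt g G s₀) (hG : 0 < G)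
    (hg0 : g s₀ = 0) (hs : s₀ ∈ Ioo x y) (hd : ∀ s ∈ Ioo x y, DifferentiableAt ℝ h s)
    (hpos : ∀ s ∈ Ioo x y, 0 < g s → 0 < deriv h s)
    (hmax : ∀ s ∈ Ioo x y, h s ≤ h s₀) : False := by
  have h1 : ∀ᶠ s in 𝓝[>] s₀, 0 < g s := by
    have := (hasDerivAt_iff_tendsto_slope.1 hg).eventually (lt_mem_nhds hG)
    have h2 : ∀ᶠ s in 𝓝[>] s₀, 0 < slope g s₀ s :=
      this.filter_mono (nhdsWithin_mono _ (fun s hs => ne_of_gt hs))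
    filter_upwards [h2, self_mem_nhdsWithin] with s h3 h4
    have h4 : s₀ < s := h4
    rw [slope_def_field, hg0, sub_zero] at h3
    have := mul_pos h3 (sub_pos.2 h4)
    rwa [div_mul_cancel₀ _ (sub_pos.2 h4).ne'] at this
  obtain ⟨u, hu, hu'⟩ := (mem_nhdsGT_iff_exists_Ioo_subset).1 h1
  have hu : s₀ < u := hu
  obtain ⟨z, hz1, hz2⟩ := exists_between (lt_min hu hs.2)
  have hz3 := lt_of_lt_of_le hz2 (min_le_left _ _)
  have hz4 := lt_of_lt_of_le hz2 (min_le_right _ _)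
  have hsub : ∀ s ∈ Icc s₀ z, s ∈ Ioo x y := fun s hs' =>
    ⟨lt_of_lt_of_le hs.1 hs'.1, lt_of_le_of_lt hs'.2 hz4⟩
  have hm : StrictMonoOn h (Icc s₀ z) := by
    apply strictMonoOn_of_deriv_pos (convex_Icc _ _)
    · intro s hs'
      exact (hd s (hsub s hs')).continuousAt.continuousWithinAt
    · intro s hs'
      rw [interior_Icc] at hs'
      exact hpos s (hsub s ⟨hs'.1.le, hs'.2.le⟩) (hu' ⟨hs'.1, hs'.2.trans hz3⟩)
  have := hm ⟨le_rfl, hz1.le⟩ ⟨hz1.le, le_rfl⟩ hz1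
  have := hmax z (hsub z ⟨hz1.le, le_rfl⟩)
  linarith

theorem ode_barrier {T d₅ κ ν ε t d M : ℝ} {η w : ℝ → ℝ}
    (hη : ∀ s ∈ Ioo (-T) T, 0 < η s ∧ DifferentiableAt ℝ η s ∧
      |deriv η s| ≤ d₅ * η s / min (T - s) (s + T)) (hd5 : 0 < d₅)
    (hε : 0 < ε) (hd : ε < d)
    (hball : Metric.ball t d ⊆ Ioo (-T) T)
    (hw : ∀ s ∈ Metric.ball t d, DifferentiableAt ℝ w s)
    (hM : 0 ≤ M) (hwM : ∀ s ∈ Metric.ball t d, w s ≤ M)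
    (hsub : ∀ s ∈ Metric.ball t d, 0 < w s →
      κ * w s * η s ≤ 2 * ε ^ 2 * deriv (fun s => deriv w s * η s) s)
    (hν : 0 < ν) (hκ : 2 * ν ^ 2 + 4 * d₅ * ν < κ) :
    w t ≤ 2 * M * Real.exp (-(ν / 2 * d) / ε) := by
  have hd0 : 0 < d := hε.trans hd
  rcases hM.eq_or_lt with rfl | hM
  · have := hwM t (Metric.mem_ball_self hd0)
    simpa using this
  have hκ0 : 0 < κ := lt_of_le_of_lt (by positivity) hκ
  set R := d / 2 with hR
  have hR0 : 0 < R := by positivity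
  set A := M / Real.cosh (ν * R / ε) with hA
  have hA0 : 0 < A := div_pos hM (Real.cosh_pos _)
  set φ : ℝ → ℝ := fun s => A * Real.cosh (ν / ε * (s - t)) with hφ
  set φ' : ℝ → ℝ := fun s => A * (ν / ε) * Real.sinh (ν / ε * (s - t)) with hφ'
  have hφpos : ∀ s, 0 < φ s := fun s => mul_pos hA0 (Real.cosh_pos _)
  have dlin : ∀ s, HasDerivAt (fun s => ν / ε * (s - t)) (ν / ε) s := fun s => by
    simpa using ((hasDerivAt_id s).sub_const t).const_mul (ν / ε)
  have dφ : ∀ s, HasDerivAt φ (φ' s) s := fun s => by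
    have := ((dlin s).cosh).const_mul A
    exact this.congr_deriv (by simp only [hφ']; ring)
  have dφ' : ∀ s, HasDerivAt φ' ((ν / ε) ^ 2 * φ s) s := fun s => by
    have := ((dlin s).sinh).const_mul (A * (ν / ε))
    exact this.congr_deriv (by simp only [hφ]; ring)
  have hφ'le : ∀ s, |φ' s| ≤ ν / ε * φ s := fun s => by
    simp only [hφ, hφ']
    rw [abs_mul, abs_of_pos (by positivity : 0 < A * (ν / ε))]
    have : |Real.sinh (ν / ε * (s - t))| ≤ Real.cosh (ν / ε * (s - t)) := by
      rw [abs_le]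
      constructor
      · have := Real.exp_pos (ν / ε * (s - t))
        rw [← Real.cosh_add_sinh] at this; linarith
      · exact (Real.sinh_lt_cosh _).le
    calc _ ≤ A * (ν / ε) * Real.cosh (ν / ε * (s - t)) := by gcongr
      _ = _ := by ring
  have hIb : ∀ s ∈ Icc (t - R) (t + R), s ∈ Metric.ball t d := fun s hs => by
    rw [Metric.mem_ball, Real.dist_eq, abs_lt]
    constructor <;> linarith [hs.1, hs.2]
  have hφR1 : φ (t - R) = M := by
    simp only [hφ]
    rw [show ν / ε * (t - R - t) = -(ν * R / ε) by ring, Real.cosh_neg, hA,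
      div_mul_cancel₀ _ (Real.cosh_pos _).ne']
  have hφR2 : φ (t + R) = M := by
    simp only [hφ]
    rw [show ν / ε * (t + R - t) = (ν * R / ε) by ring, hA,
      div_mul_cancel₀ _ (Real.cosh_pos _).ne']
  set h : ℝ → ℝ := fun s => w s - φ s with hh
  have hcont : ContinuousOn h (Icc (t - R) (t + R)) := fun s hs =>
    ((hw s (hIb s hs)).continuousAt.sub (dφ s).continuousAt).continuousWithinAt
  obtain ⟨s₀, hs₀, hmax⟩ := isCompact_Icc.exists_isMaxOn ⟨t, by constructor <;> linarith⟩ hcont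
  have hmax' : ∀ s ∈ Icc (t - R) (t + R), h s ≤ h s₀ := fun s hs => hmax hs
  have key : h s₀ ≤ 0 := by
    by_contra! hpos
    have hs₀b := hIb s₀ hs₀
    have hs1 : t - R < s₀ := by
      rcases hs₀.1.eq_or_lt with h1 | h1
      · exfalso
        have := hwM s₀ hs₀b
        simp only [hh] at hpos; rw [← h1] at hpos this
        linarith
      · exact h1
    have hs2 : s₀ < t + R := by
      rcases hs₀.2.eq_or_lt with h1 | h1
      · exfalso
        have := hwM s₀ hs₀b
        simp only [hh] at hpos; rw [h1] at hpos this
        linarith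
      · exact h1
    have hIoo := hball hs₀b
    obtain ⟨η0, ηd, ηb⟩ := hη s₀ hIoo
    have hwφ : φ s₀ < w s₀ := by simpa [hh] using hpos
    have hw0 : 0 < w s₀ := (hφpos s₀).trans hwφ
    have hs := hsub s₀ hs₀b hw0
    have hPpos : 0 < deriv (fun s => deriv w s * η s) s₀ := by
      by_contra! hc
      have h1 : 0 < κ * w s₀ * η s₀ := by positivity
      have h2 : 2 * ε ^ 2 * deriv (fun s => deriv w s * η s) s₀ ≤ 0 :=
        mul_nonpos_of_nonneg_of_nonpos (by positivity) hc
      linarith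
    have hP := (differentiableAt_of_deriv_ne_zero hPpos.ne').hasDerivAt
    have hQ := (dφ' s₀).mul ηd.hasDerivAt
    have hg := hP.sub hQ
    have hmin : R ≤ min (T - s₀) (s₀ + T) := by
      have e1 : t + d ≤ T := by
        by_contra! hc
        have h3 : max T t ∈ Metric.ball t d := by
          rw [Metric.mem_ball, Real.dist_eq, abs_lt]
          constructor
          · linarith [le_max_right T t]
          · have : max T t < t + d := max_lt hc (by linarith)
            linarith
        have := (hball h3).2
        linarith [le_max_left T t]
      have e2 : -T ≤ t - d := by
        by_contra! hc
        have h3 : min (-T) t ∈ Metric.ball t d := by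
          rw [Metric.mem_ball, Real.dist_eq, abs_lt]
          constructor
          · have : t - d < min (-T) t := lt_min hc (by linarith)
            linarith
          · linarith [min_le_right (-T) t]
        have := (hball h3).1
        linarith [min_le_left (-T) t]
      apply le_min <;> linarith
    have hηb : |deriv η s₀| ≤ 2 * d₅ * η s₀ / ε := by
      refine ηb.trans ?_
      rw [div_le_div_iff₀ (lt_of_lt_of_le hR0 hmin) hε]
      have : ε ≤ 2 * min (T - s₀) (s₀ + T) := by linarith
      have h5 : 0 < d₅ * η s₀ := by positivity
      nlinarith
    have hQb : 2 * ε ^ 2 * ((ν / ε) ^ 2 * φ s₀ * η s₀ + φ' s₀ * deriv η s₀)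
        ≤ (2 * ν ^ 2 + 4 * d₅ * ν) * (φ s₀ * η s₀) := by
      have h6 : φ' s₀ * deriv η s₀ ≤ (ν / ε * φ s₀) * (2 * d₅ * η s₀ / ε) := by
        calc _ ≤ |φ' s₀ * deriv η s₀| := le_abs_self _
          _ = |φ' s₀| * |deriv η s₀| := abs_mul _ _
          _ ≤ _ := mul_le_mul (hφ'le _) hηb (abs_nonneg _)
            (by have := hφpos s₀; positivity)
      calc _ ≤ 2 * ε ^ 2 * ((ν / ε) ^ 2 * φ s₀ * η s₀ + (ν / ε * φ s₀) * (2 * d₅ * η s₀ / ε)) := by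
            gcongr
        _ = _ := by field_simp; ring
    have hG : 0 < deriv (fun s => deriv w s * η s) s₀
        - ((ν / ε) ^ 2 * φ s₀ * η s₀ + φ' s₀ * deriv η s₀) := by
      have h7 : 0 < φ s₀ * η s₀ := mul_pos (hφpos _) η0
      have h8 : (2 * ν ^ 2 + 4 * d₅ * ν) * (φ s₀ * η s₀) < κ * (φ s₀ * η s₀) :=
        mul_lt_mul_of_pos_right hκ h7
      have h9 : κ * (φ s₀ * η s₀) < κ * w s₀ * η s₀ := by
        rw [mul_assoc κ (w s₀)]
        exact mul_lt_mul_of_pos_left (mul_lt_mul_of_pos_right hwφ η0) hκ0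
      have h10 : 0 < 2 * ε ^ 2 * (deriv (fun s => deriv w s * η s) s₀
        - ((ν / ε) ^ 2 * φ s₀ * η s₀ + φ' s₀ * deriv η s₀)) := by
        rw [mul_sub]; linarith
      exact (pos_iff_pos_of_mul_pos h10).1 (by positivity)
    have hdh : ∀ s ∈ Ioo (t - R) (t + R), HasDerivAt h (deriv w s - φ' s) s := fun s hs =>
      (hw s (hIb s ⟨hs.1.le, hs.2.le⟩)).hasDerivAt.sub (dφ s)
    have hloc : IsLocalMax h s₀ := by
      filter_upwards [Ioo_mem_nhds hs1 hs2] with s hs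
      exact hmax' s ⟨hs.1.le, hs.2.le⟩
    have hz := hloc.hasDerivAt_eq_zero (hdh s₀ ⟨hs1, hs2⟩)
    refine local_max_aux (h := h) (x := t - R) (y := t + R) hg hG ?_ ⟨hs1, hs2⟩
      (fun s hs => (hdh s hs).differentiableAt) ?_
      (fun s hs => hmax' s ⟨hs.1.le, hs.2.le⟩)
    · simp only [Pi.sub_apply, Pi.mul_apply]
      rw [← sub_mul, hz, zero_mul]
    · intro s hs hgs
      simp only [Pi.sub_apply, Pi.mul_apply] at hgs
      rw [(hdh s hs).deriv]
      rw [← sub_mul] at hgs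
      exact (pos_iff_pos_of_mul_pos hgs).2 (hη s (hball (hIb s ⟨hs.1.le, hs.2.le⟩))).1
  have ht : h t ≤ 0 := (hmax' t (by constructor <;> linarith)).trans key
  have ht' : w t ≤ A := by simpa [hh, hφ] using ht
  refine ht'.trans ?_
  rw [hA, div_le_iff₀ (Real.cosh_pos _), Real.cosh_eq,
    show -(ν / 2 * d) / ε = -(ν * R / ε) by rw [hR]; ring]
  have h1 : Real.exp (-(ν * R / ε)) * Real.exp (ν * R / ε) = 1 := by
    rw [← Real.exp_add]; simp
  have h2 := Real.exp_pos (-(ν * R / ε))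
  have : 2 * M * Real.exp (-(ν * R / ε)) *
      ((Real.exp (ν * R / ε) + Real.exp (-(ν * R / ε))) / 2)
      = M * (Real.exp (-(ν * R / ε)) * Real.exp (ν * R / ε))
        + M * Real.exp (-(ν * R / ε)) ^ 2 := by ring
  rw [this, h1]
  nlinarith [mul_pos hM (pow_pos h2 2)]

theorem DoubleWell.reflect {W : ℝ → ℝ} {a b c q l : ℝ} (hW : DoubleWell W a b c q l) :
    DoubleWell (fun x => W (-x)) (-b) (-a) (-c) q l := by
  have hd : deriv (fun x => W (-x)) = fun x => -deriv W (-x) := by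
    funext x; exact deriv_comp_neg W x
  have hdd : ∀ x, deriv (deriv (fun x => W (-x))) x = deriv (deriv W) (-x) := by
    intro x
    rw [hd, deriv.fun_neg, deriv_comp_neg, neg_neg]
  have hneg : ∀ p : ℝ, Tendsto (fun x : ℝ => -x) (𝓝[≠] (-p)) (𝓝[≠] p) := by
    intro p
    apply tendsto_nhdsWithin_of_tendsto_nhds_of_eventually_within
    · have : Tendsto (fun x : ℝ => -x) (𝓝 (-p)) (𝓝 (- -p)) := continuous_neg.tendsto _
      rw [neg_neg] at this
      exact this.mono_left nhdsWithin_le_nhds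
    · filter_upwards [self_mem_nhdsWithin] with x hx
      intro h
      apply hx
      have : -x = p := h
      simp [← this]
  refine ⟨neg_lt_neg hW.lt_ab, neg_lt_neg hW.lt_cb, neg_lt_neg hW.lt_ac, fun s => hW.nonneg _,
    ?_, ?_, hW.q_mem, hW.l_pos, ?_, ?_, ?_, ?_, ?_⟩
  · refine hW.smooth.comp contDiff_neg.contDiffOn ?_
    intro x hx
    simp only [mem_compl_iff, mem_insert_iff, mem_singleton_iff, not_or] at hx ⊢
    exact ⟨fun h => hx.2 (by rw [← h, neg_neg]), fun h => hx.1 (by rw [← h, neg_neg])⟩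
  · intro s
    rw [hW.zeros]
    constructor
    · rintro (h | h)
      · right; linarith
      · left; linarith
    · rintro (h | h)
      · right; linarith
      · left; linarith
  · refine (hW.lim_b.comp (hneg b)).congr fun x => ?_
    simp only [Function.comp, hdd]
    rw [show -x - b = -(x - -b) by ring, abs_neg]
  · refine (hW.lim_a.comp (hneg a)).congr fun x => ?_
    simp only [Function.comp, hdd]
    rw [show -x - a = -(x - -a) by ring, abs_neg]
  · intro s
    rw [hd]
    simp only [neg_eq_zero]
    rw [hW.deriv_zeros]
    constructor
    · rintro (h | h | h)
      · right; right; linarith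
      · right; left; linarith
      · left; linarith
    · rintro (h | h | h)
      · right; right; linarith
      · right; left; linarith
      · left; linarith
  · rw [hdd, neg_neg]; exact hW.concave_c
  · obtain ⟨L, hL, R, h⟩ := hW.coercive
    refine ⟨L, hL, R, fun s hs => ?_⟩
    rw [hd]
    simp only [abs_neg]
    exact h _ (by rwa [abs_neg])

theorem DoubleWell.isOpen_U (a b : ℝ) : IsOpen (({a, b} : Set ℝ)ᶜ) :=
  ((Set.toFinite _).isClosed).isOpen_compl

theorem DoubleWell.derivC1 {W : ℝ → ℝ} {a b c q l : ℝ} (hW : DoubleWell W a b c q l) :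
    ContDiffOn ℝ 1 (deriv W) (({a, b} : Set ℝ)ᶜ) :=
  hW.smooth.deriv_of_isOpen (DoubleWell.isOpen_U a b) (by norm_num)

theorem DoubleWell.diffAt {W : ℝ → ℝ} {a b c q l : ℝ} (hW : DoubleWell W a b c q l) {s : ℝ}
    (ha : s ≠ a) (hb : s ≠ b) : DifferentiableAt ℝ (deriv W) s :=
  (hW.derivC1.differentiableOn one_ne_zero).differentiableAt
    ((DoubleWell.isOpen_U a b).mem_nhds (by simp [ha, hb]))

theorem const_sign {f : ℝ → ℝ} {S : Set ℝ} (hS : S.OrdConnected) (hf : ∀ s ∈ S, ContinuousAt f s)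
    (h0 : ∀ s ∈ S, f s ≠ 0) {x y : ℝ} (hx : x ∈ S) (hy : y ∈ S) (hfx : f x < 0) : f y < 0 := by
  by_contra! h
  have := hS.isPreconnected.intermediate_value hx hy
    (fun s hs => (hf s hs).continuousWithinAt)
  obtain ⟨z, hz, hz0⟩ := this ⟨hfx.le, h⟩
  exact h0 z hz hz0

/-- `W'` is negative on `(c,b)`. -/
theorem DoubleWell.neg_cb {W : ℝ → ℝ} {a b c q l : ℝ} (hW : DoubleWell W a b c q l) {s : ℝ}
    (hs : s ∈ Ioo c b) : deriv W s < 0 := by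
  have hac := hW.lt_ac
  have hcb := hW.lt_cb
  have hev := eventually_nhdsWithin_sign_eq_of_deriv_pos (f := fun x => -deriv W x) (x₀ := c)
    (by rw [deriv.fun_neg]; exact neg_pos.2 hW.concave_c)
    (by simp [(hW.deriv_zeros c).2])
  have h2 : ∀ᶠ x in 𝓝[>] c, SignType.sign (-deriv W x) = SignType.sign (x - c) :=
    hev.filter_mono nhdsWithin_le_nhds
  obtain ⟨x, hx1, hx2⟩ := (h2.and (Ioo_mem_nhdsGT hcb)).exists
  rw [sign_pos (sub_pos.2 hx2.1), sign_eq_one_iff] at hx1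
  refine const_sign (S := Ioo c b) ordConnected_Ioo ?_ ?_ hx2 hs (by linarith)
  · intro y hy
    exact (hW.diffAt (by linarith [hy.1] : a < y).ne' hy.2.ne).continuousAt
  · intro y hy h
    rcases (hW.deriv_zeros y).1 h with h | h | h <;> linarith [hy.1, hy.2]

/-- `W'` is positive on `(b,∞)`. -/
theorem DoubleWell.pos_b {W : ℝ → ℝ} {a b c q l : ℝ} (hW : DoubleWell W a b c q l) {s : ℝ}
    (hs : b < s) : 0 < deriv W s := by
  have hab := hW.lt_ab
  have hcb := hW.lt_cb
  by_contra! hneg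
  have hne : ∀ y, b < y → deriv W y ≠ 0 := by
    intro y hy h
    rcases (hW.deriv_zeros y).1 h with h | h | h <;> linarith
  have hneg' : deriv W s < 0 := lt_of_le_of_ne hneg (hne s hs)
  have hall : ∀ y, b < y → deriv W y < 0 := fun y hy =>
    const_sign (S := Ioi b) ordConnected_Ioi
      (fun z hz => (hW.diffAt (hab.trans hz).ne' (ne_of_gt hz)).continuousAt) (fun z hz => hne z hz)
      hs hy hneg'
  obtain ⟨L, hL, R, hR⟩ := hW.coercive
  set x := max R (b + 1) with hx
  have hxb : b < x := by linarith [le_max_right R (b + 1)]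
  have hWd : ∀ y, b < y → DifferentiableAt ℝ W y := fun y hy =>
    differentiableAt_of_deriv_ne_zero (hne y hy)
  have hb : ∀ y, x ≤ y → deriv W y ≤ -L := by
    intro y hy
    have h1 := hR y (((le_max_left _ _).trans hy).trans (le_abs_self y))
    rw [abs_of_neg (hall y (hxb.trans_le hy))] at h1
    linarith
  have := (convex_Ici x).image_sub_le_mul_sub_of_deriv_le (f := W) (C := -L)
    (fun y hy => (hWd y (hxb.trans_le hy)).continuousAt.continuousWithinAt)
    (fun y hy => (hWd y (hxb.trans_le (interior_subset hy))).differentiableWithinAt)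
    (fun y hy => hb y (interior_subset hy)) x (self_mem_Ici) (x + (W x + 1) / L)
    (by
      have : 0 ≤ (W x + 1) / L := by have := hW.nonneg x; positivity
      simpa using this)
    (by
      have : 0 ≤ (W x + 1) / L := by have := hW.nonneg x; positivity
      linarith)
  rw [add_sub_cancel_left, neg_mul, mul_div_cancel₀ _ hL.ne'] at this
  linarith [hW.nonneg (x + (W x + 1) / L)]

/-- Uniform monotonicity of `W'` near `b`. -/
theorem DoubleWell.mono_b {W : ℝ → ℝ} {a b c q l : ℝ} (hW : DoubleWell W a b c q l) :
    ∃ κ > 0, ∃ r > 0, ∀ x ∈ Ioo (b - r) (b + r), ∀ y ∈ Ioo (b - r) (b + r), x ≤ y →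
      κ * (y - x) ≤ deriv W y - deriv W x := by
  have hac := hW.lt_ac
  have hcb := hW.lt_cb
  have hl := hW.l_pos
  have h1 := hW.lim_b.eventually (lt_mem_nhds (half_lt_self hl))
  rw [eventually_nhdsWithin_iff, Metric.eventually_nhds_iff] at h1
  obtain ⟨r₀, hr₀, h1⟩ := h1
  set r := min r₀ (min 1 (b - c)) with hr
  have hr1 : r ≤ r₀ := min_le_left _ _
  have hr2 : r ≤ 1 := (min_le_right _ _).trans (min_le_left _ _)
  have hr3 : r ≤ b - c := (min_le_right _ _).trans (min_le_right _ _)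
  have hr0 : 0 < r := lt_min hr₀ (lt_min one_pos (by linarith))
  have hdd : ∀ s ∈ Ioo (b - r) (b + r), s ≠ b → l / 2 ≤ deriv (deriv W) s := by
    intro s hs hsb
    have habs : |s - b| < r := by rw [abs_lt]; constructor <;> linarith [hs.1, hs.2]
    have h2 := h1 (by rw [Real.dist_eq]; linarith) hsb
    have hpos : 0 < |s - b| := abs_pos.2 (sub_ne_zero.2 hsb)
    have h3 := Real.one_le_rpow_of_pos_of_le_one_of_nonpos hpos (by linarith)
      (by linarith [hW.q_mem.2] : q - 1 ≤ 0)
    rw [lt_div_iff₀ (by linarith)] at h2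
    nlinarith
  have hdiff : ∀ s ∈ Ioo (b - r) (b + r), s ≠ b → DifferentiableAt ℝ (deriv W) s := fun s hs hsb =>
    hW.diffAt (by linarith [hs.1] : a < s).ne' hsb
  have hseg : ∀ S : Set ℝ, Convex ℝ S → (∀ s ∈ S, s ∈ Ioo (b - r) (b + r) ∧ s ≠ b) →
      ∀ x ∈ S, ∀ y ∈ S, x ≤ y → l / 2 * (y - x) ≤ deriv W y - deriv W x := by
    intro S hS hSb
    exact hS.mul_sub_le_image_sub_of_le_deriv
      (fun s hs => (hdiff s (hSb s hs).1 (hSb s hs).2).continuousAt.continuousWithinAt)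
      (fun s hs => (hdiff s (hSb s (interior_subset hs)).1
        (hSb s (interior_subset hs)).2).differentiableWithinAt)
      (fun s hs => hdd s (hSb s (interior_subset hs)).1 (hSb s (interior_subset hs)).2)
  have hleft := hseg (Ioo (b - r) b) (convex_Ioo _ _)
    (fun s hs => ⟨⟨hs.1, by linarith [hs.2]⟩, hs.2.ne⟩)
  have hright := hseg (Ioo b (b + r)) (convex_Ioo _ _)
    (fun s hs => ⟨⟨by linarith [hs.1], hs.2⟩, hs.1.ne'⟩)
  have hb0 : deriv W b = 0 := (hW.deriv_zeros b).2 (Or.inr (Or.inr rfl))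
  have hl' : ∀ x ∈ Ioo (b - r) b, l / 2 * (b - x) ≤ -deriv W x := by
    intro x hx
    apply le_of_forall_pos_le_add
    intro e he
    by_contra! hc
    obtain ⟨z, hz1, hz2⟩ := exists_between (max_lt hx.2 (by
      have : 0 < e / l := by positivity
      linarith : b - e / l < b))
    have hz3 := (le_max_left _ _).trans_lt hz1
    have hz4 := (le_max_right _ _).trans_lt hz1
    have h5 := hleft x hx z ⟨hx.1.trans hz3, hz2⟩ hz3.le
    have h6 := hW.neg_cb (s := z) ⟨by linarith [hx.1], hz2⟩
    have h7 : l * (b - z) < e := by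
      have : b - z < e / l := by linarith
      rw [lt_div_iff₀ hl] at this
      linarith
    have h8 : l / 2 * (b - x) = l / 2 * (z - x) + l * (b - z) / 2 := by ring
    linarith
  have hr' : ∀ y ∈ Ioo b (b + r), l / 2 * (y - b) ≤ deriv W y := by
    intro y hy
    apply le_of_forall_pos_le_add
    intro e he
    by_contra! hc
    obtain ⟨z, hz1, hz2⟩ := exists_between (lt_min hy.1 (by
      have : 0 < e / l := by positivity
      linarith : b < b + e / l))
    have hz3 := hz2.trans_le (min_le_left _ _)
    have hz4 := hz2.trans_le (min_le_right _ _)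
    have h5 := hright z ⟨hz1, hz3.trans hy.2⟩ y hy hz3.le
    have h6 := hW.pos_b hz1
    have h7 : l * (z - b) < e := by
      have : z - b < e / l := by linarith
      rw [lt_div_iff₀ hl] at this
      linarith
    have h8 : l / 2 * (y - b) = l / 2 * (y - z) + l * (z - b) / 2 := by ring
    linarith
  refine ⟨l / 2, by positivity, r, hr0, fun x hx y hy hxy => ?_⟩
  rcases lt_trichotomy x b with h | h | h <;> rcases lt_trichotomy y b with h' | h' | h'
  · exact hleft x ⟨hx.1, h⟩ y ⟨hy.1, h'⟩ hxy
  · rw [h', hb0]; linarith [hl' x ⟨hx.1, h⟩]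
  · have := hl' x ⟨hx.1, h⟩
    have := hr' y ⟨h', hy.2⟩
    linarith
  · linarith
  · rw [h, h', hb0]; simp
  · rw [h, hb0]; linarith [hr' y ⟨h', hy.2⟩]
  · linarith
  · linarith
  · exact hright x ⟨h, hx.2⟩ y ⟨h', hy.2⟩ hxy

/-- The key one-sided inequality on the upper phase. -/
theorem DoubleWell.key_b {W : ℝ → ℝ} {a b c q l : ℝ} (hW : DoubleWell W a b c q l)
    {ρ : ℝ} (hρ : 0 < ρ) :
    ∃ r₁ > 0, ∃ κ > 0, ∃ k > 0, ∀ y ∈ Ioo (b - r₁) (b + r₁), |deriv W y| < k →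
      ∀ s ∈ Icc (c + ρ) y, κ * (y - s) ≤ deriv W y - deriv W s := by
  have hac := hW.lt_ac
  obtain ⟨κ, hκ, r, hr, hm⟩ := hW.mono_b
  obtain ⟨k, hk, hk'⟩ := (isCompact_Icc (a := c + ρ) (b := b - r)).exists_forall_le'
    (f := fun s => -deriv W s) (a := 0)
    (fun s hs => ((hW.diffAt (by linarith [hs.1] : a < s).ne'
      (by linarith [hs.2] : s < b).ne).continuousAt.neg).continuousWithinAt)
    (fun s hs => neg_pos.2 (hW.neg_cb ⟨by linarith [hs.1], by linarith [hs.2]⟩))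
  set N := |b| + r + |c + ρ| + 1 with hN
  have hN0 : 0 < N := by positivity
  refine ⟨r, hr, min κ (k / 2 / N), by positivity, k / 2, by positivity, ?_⟩
  intro y hy hyk s hs
  by_cases hsr : b - r < s
  · have := hm s ⟨hsr, hs.2.trans_lt hy.2⟩ y hy hs.2
    refine le_trans ?_ this
    exact mul_le_mul_of_nonneg_right (min_le_left _ _) (by linarith [hs.2])
  · have h1 := hk' s ⟨hs.1, not_lt.1 hsr⟩
    have h2 := (abs_lt.1 hyk).1
    have h3 : y - s ≤ N := by
      linarith [hs.1, hy.2, le_abs_self b, neg_abs_le (c + ρ)]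
    calc _ ≤ k / 2 / N * N := mul_le_mul (min_le_right _ _) h3 (by linarith [hs.2]) (by positivity)
      _ = k / 2 := by field_simp
      _ ≤ _ := by linarith

/-- Localisation of the zeros of `W' + x`. -/
theorem DoubleWell.localize {W : ℝ → ℝ} {a b c q l : ℝ} (hW : DoubleWell W a b c q l)
    {r : ℝ} (hr : 0 < r) :
    ∃ k > 0, ∀ x y z : ℝ, x < y → y < z → deriv W x = deriv W y → deriv W y = deriv W z →
      |deriv W x| < k → x ∈ Ioo (a - r) (a + r) ∧ z ∈ Ioo (b - r) (b + r) := by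
  have hac := hW.lt_ac
  have hcb := hW.lt_cb
  obtain ⟨κb, hκb, rb, hrb, hmb⟩ := hW.mono_b
  obtain ⟨κa, hκa, ra, hra, hma⟩ := hW.reflect.mono_b
  have hca : ContinuousAt (deriv (deriv W)) c :=
    ((hW.derivC1.continuousOn_deriv_of_isOpen (DoubleWell.isOpen_U a b) le_rfl).continuousAt
      ((DoubleWell.isOpen_U a b).mem_nhds (by simp [hac.ne', hcb.ne])))
  have hcn := hca.eventually (gt_mem_nhds hW.concave_c)
  rw [Metric.eventually_nhds_iff] at hcn
  obtain ⟨rc, hrc, hcn⟩ := hcn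
  obtain ⟨R, hR0, hR1, hR2, hR3, hR4, hR5, hR6⟩ : ∃ R > 0, R ≤ r ∧ R ≤ rb ∧ R ≤ ra ∧ R ≤ rc ∧
      R ≤ (c - a) / 2 ∧ R ≤ (b - c) / 2 :=
    ⟨min r (min rb (min ra (min rc (min ((c - a) / 2) ((b - c) / 2))))), by
      have : 0 < c - a := by linarith
      have : 0 < b - c := by linarith
      positivity, by simp, by simp, by simp, by simp, by simp, by simp⟩
  have ib : ∀ x ∈ Ioo (b - R) (b + R), ∀ y ∈ Ioo (b - R) (b + R), x < y →
      deriv W x ≠ deriv W y := by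
    intro x hx y hy hxy h
    have := hmb x ⟨by linarith [hx.1], by linarith [hx.2]⟩ y
      ⟨by linarith [hy.1], by linarith [hy.2]⟩ hxy.le
    have h2 : 0 < κb * (y - x) := mul_pos hκb (by linarith)
    linarith
  have ia : ∀ x ∈ Ioo (a - R) (a + R), ∀ y ∈ Ioo (a - R) (a + R), x < y →
      deriv W x ≠ deriv W y := by
    intro x hx y hy hxy h
    have := hma (-y) ⟨by linarith [hy.2], by linarith [hy.1]⟩ (-x)
      ⟨by linarith [hx.2], by linarith [hx.1]⟩ (by linarith)
    rw [deriv_comp_neg, deriv_comp_neg, neg_neg, neg_neg] at this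
    have h2 : 0 < κa * (-x - -y) := mul_pos hκa (by linarith)
    linarith
  have ic : ∀ x ∈ Ioo (c - R) (c + R), ∀ y ∈ Ioo (c - R) (c + R), x < y →
      deriv W x ≠ deriv W y := by
    have hanti : StrictAntiOn (deriv W) (Ioo (c - R) (c + R)) := by
      apply strictAntiOn_of_deriv_neg (convex_Ioo _ _)
      · intro s hs
        exact (hW.diffAt (by linarith [hs.1] : a < s).ne'
          (by linarith [hs.2] : s < b).ne).continuousAt.continuousWithinAt
      · intro s hs
        have hs := interior_subset hs
        apply hcn
        rw [Real.dist_eq, abs_lt]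
        constructor <;> linarith [hs.1, hs.2]
    intro x hx y hy hxy h
    have := hanti hx hy hxy
    linarith
  obtain ⟨L, hL, Q, hQ⟩ := hW.coercive
  set K := Icc (-Q) Q \ (Ioo (a - R) (a + R) ∪ Ioo (b - R) (b + R) ∪ Ioo (c - R) (c + R)) with hK
  have hKc : IsCompact K := isCompact_Icc.diff ((isOpen_Ioo.union isOpen_Ioo).union isOpen_Ioo)
  have hKn : ∀ s ∈ K, s ≠ a ∧ s ≠ b ∧ s ≠ c := by
    intro s hs
    refine ⟨?_, ?_, ?_⟩ <;> rintro rfl <;> apply hs.2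
    · left; left; constructor <;> linarith
    · left; right; constructor <;> linarith
    · right; constructor <;> linarith
  obtain ⟨k, hk, hk'⟩ := hKc.exists_forall_le' (f := fun s => |deriv W s|) (a := 0)
    (fun s hs => ((hW.diffAt (hKn s hs).1 (hKn s hs).2.1).continuousAt.abs).continuousWithinAt)
    (fun s hs => abs_pos.2 (fun h => by
      have := hKn s hs
      rcases (hW.deriv_zeros s).1 h with h | h | h <;> tauto))
  have hloc : ∀ s, |deriv W s| < min k L → s ∈ Ioo (a - R) (a + R) ∨ s ∈ Ioo (b - R) (b + R) ∨
      s ∈ Ioo (c - R) (c + R) := by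
    intro s hs
    by_contra! hcon
    by_cases hsQ : s ∈ Icc (-Q) Q
    · have := hk' s ⟨hsQ, by
        rintro ((h | h) | h)
        · exact hcon.1 h
        · exact hcon.2.1 h
        · exact hcon.2.2 h⟩
      linarith [hs.trans_le (min_le_left _ _)]
    · have : Q ≤ |s| := by
        by_contra! h
        exact hsQ ⟨(abs_lt.1 h).1.le, (abs_lt.1 h).2.le⟩
      linarith [hQ s this, hs.trans_le (min_le_right _ _)]
  refine ⟨min k L, lt_min hk hL, ?_⟩
  intro x y z hxy hyz h1 h2 hx
  have hy : |deriv W y| < min k L := h1 ▸ hx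
  have hz : |deriv W z| < min k L := h2 ▸ hy
  have h3 := h1.trans h2
  have hxz := hxy.trans hyz
  rcases hloc x hx with hx | hx | hx <;> rcases hloc y hy with hy | hy | hy <;>
    rcases hloc z hz with hz | hz | hz <;>
    first
    | exact (ia x hx y hy hxy h1).elim
    | exact (ib x hx y hy hxy h1).elim
    | exact (ic x hx y hy hxy h1).elim
    | exact (ia y hy z hz hyz h2).elim
    | exact (ib y hy z hz hyz h2).elim
    | exact (ic y hy z hz hyz h2).elim
    | exact (ia x hx z hz hxz h3).elim
    | exact (ib x hx z hz hxz h3).elim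
    | exact (ic x hx z hz hxz h3).elim
    | (exfalso; linarith [hx.1, hx.2, hy.1, hy.2, hz.1, hz.2])
    | exact ⟨⟨by linarith [hx.1], by linarith [hx.2]⟩, ⟨by linarith [hz.1], by linarith [hz.2]⟩⟩

theorem phase_barrier {T d₅ κ ν ε μ M : ℝ} {η w : ℝ → ℝ} {J : Set ℝ}
    (hη : ∀ s ∈ Ioo (-T) T, 0 < η s ∧ DifferentiableAt ℝ η s ∧
      |deriv η s| ≤ d₅ * η s / min (T - s) (s + T)) (hd5 : 0 < d₅)
    (hε : 0 < ε) (hJ : J ⊆ Icc (-T) T)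
    (hw : ∀ s ∈ Ioo (-T) T, DifferentiableAt ℝ w s)
    (hM : 0 ≤ M) (hwM : ∀ s ∈ J, w s ≤ M)
    (hsub : ∀ s ∈ J, s ∈ Ioo (-T) T →
      κ * w s * η s ≤ 2 * ε ^ 2 * deriv (fun s => deriv w s * η s) s)
    (hν : 0 < ν) (hκ : 2 * ν ^ 2 + 4 * d₅ * ν < κ) (hμ0 : 0 < μ) (hμ1 : μ ≤ ν / 2)
    (hμ2 : μ ≤ Real.log 2) {t : ℝ} (ht : t ∈ J) :
    w t ≤ 2 * M * Real.exp (-(μ * Metric.infDist t Jᶜ) / ε) := by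
  set d := Metric.infDist t Jᶜ with hd
  have hballJ : Metric.ball t d ⊆ J := by
    intro s hs
    by_contra hsJ
    have := Metric.infDist_le_dist_of_mem (x := t) (show s ∈ Jᶜ from hsJ)
    rw [Metric.mem_ball, dist_comm] at hs
    linarith
  by_cases hdε : d ≤ ε
  · refine (hwM t ht).trans ?_
    have h1 : -Real.log 2 ≤ -(μ * d) / ε := by
      rw [neg_div, neg_le_neg_iff, div_le_iff₀ hε]
      exact mul_le_mul hμ2 hdε Metric.infDist_nonneg (hμ0.le.trans hμ2)
    have h2 := Real.exp_le_exp.2 h1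
    rw [Real.exp_neg, Real.exp_log two_pos] at h2
    nlinarith
  · have hdε : ε < d := not_le.1 hdε
    have hball : Metric.ball t d ⊆ Ioo (-T) T := by
      have := interior_mono (hballJ.trans hJ)
      rwa [interior_Icc, Metric.isOpen_ball.interior_eq] at this
    have := ode_barrier hη hd5 hε hdε hball (fun s hs => hw s (hball hs)) hM
      (fun s hs => hwM s (hballJ hs)) (fun s hs _ => hsub s (hballJ hs) (hball hs)) hν hκ
    refine this.trans ?_
    have h0 : 0 < d := hε.trans hdε
    gcongr

/-- **Exponential barrier estimate** (Lemma 4.12). For `δ` sufficiently small, let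
`v_ε` be global minimizers of `J_ε` satisfying the Euler–Lagrange equation with
multipliers `λ_ε → λ₀`, and let `a_ε < c_ε < b_ε` be the zeros of `W' + ε λ_ε`
bounding `v_ε`. Fix `ρ ∈ (0, ½ min{c-a, b-c})` and exponents
`1/nᵢ < θᵢ < 1/(nᵢ-1)`. Then there are `μ > 0` and `ε₀ > 0` such that for
`ε ∈ (0,ε₀)`, on every maximal interval of
`{t ∈ [-T + c(n₁) ε^θ₁, T - c(n₂) ε^θ₂] : v_ε(t) ≥ c + ρ}` one has
`b_ε - v_ε(t) ≤ 2 (b_ε - c - ρ) exp(-μ d(t, I_εᶜ)/ε)`, and the analogous estimate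
on maximal intervals of `{t : v_ε(t) ≤ c - ρ}`. -/
theorem exponential_barrier_estimate
    (W : ℝ → ℝ) (a b c q l : ℝ) (hW : DoubleWell W a b c q l)
    (T : ℝ) (hT : 0 < T)
    (η : ℝ → ℝ) (β : ℝ) (n₁ n₂ : ℕ) (d₁ d₂ d₃ d₄ d₅ tstar : ℝ)
    (hη : GoodWeight T η β n₁ n₂ d₁ d₂ d₃ d₄ d₅ tstar)
    (m : ℝ)
    (hm₁ : a * (∫ t in Set.Ioo (-T) T, η t) < m)
    (hm₂ : m < b * ∫ t in Set.Ioo (-T) T, η t)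
    (cW : ℝ) (hcW : cW = ∫ s in a..b, Real.sqrt (W s))
    (t₀ : ℝ) (ht₀ : t₀ ∈ Set.Ioo (-T) T)
    (hmass₀ : massEq T η m (stepAB a b t₀)) :
    ∃ δ₀ > 0, ∀ δ : ℝ, 0 < δ → δ ≤ δ₀ →
      ∀ (vf : ℝ → (ℝ → ℝ)) (lam aE cE bE : ℝ → ℝ),
        (∀ ε ∈ Set.Ioi (0 : ℝ), IsJMin T W η m δ ε (stepAB a b t₀) (vf ε)) →
        (∀ᶠ ε in 𝓝[>] (0 : ℝ), ∀ t ∈ Set.Ioo (-T) T,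
          2 * ε ^ 2 * deriv (fun s => deriv (vf ε) s * η s) t
            - deriv W (vf ε t) * η t = ε * lam ε * η t) →
        Filter.Tendsto lam (𝓝[>] (0 : ℝ))
          (𝓝 (2 * deriv η t₀ * cW / ((b - a) * η t₀))) →
        (∀ᶠ ε in 𝓝[>] (0 : ℝ),
          (∀ s : ℝ, deriv W s + ε * lam ε = 0 ↔ s = aE ε ∨ s = cE ε ∨ s = bE ε) ∧
          aE ε < cE ε ∧ cE ε < bE ε ∧
          (∀ t ∈ Set.Ioo (-T) T, aE ε ≤ vf ε t ∧ vf ε t ≤ bE ε)) →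
        ∀ ρ : ℝ, 0 < ρ → ρ < (1 / 2) * min (c - a) (b - c) →
        ∀ θ₁ θ₂ : ℝ,
          1 / (n₁ : ℝ) < θ₁ → ((n₁ : ℝ) - 1) * θ₁ < 1 →
          1 / (n₂ : ℝ) < θ₂ → ((n₂ : ℝ) - 1) * θ₂ < 1 →
        ∃ μ > 0, ∃ ε₀ > 0, ∀ ε ∈ Set.Ioo (0 : ℝ) ε₀,
          -- barrier estimate on the upper phase
          (∀ J : Set ℝ,
            MaxSubInterval
              {t ∈ Set.Icc (-T + cnn n₁ * ε ^ θ₁) (T - cnn n₂ * ε ^ θ₂) |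
                c + ρ ≤ vf ε t} J →
            ∀ t ∈ J, bE ε - vf ε t ≤
              2 * (bE ε - c - ρ) * Real.exp (-(μ * Metric.infDist t Jᶜ) / ε)) ∧
          -- barrier estimate on the lower phase
          (∀ J : Set ℝ,
            MaxSubInterval
              {t ∈ Set.Icc (-T + cnn n₁ * ε ^ θ₁) (T - cnn n₂ * ε ^ θ₂) |
                vf ε t ≤ c - ρ} J →
            ∀ t ∈ J, vf ε t - aE ε ≤
              2 * (c - ρ - aE ε) * Real.exp (-(μ * Metric.infDist t Jᶜ) / ε)) := by
  have hac := hW.lt_ac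
  have hcb := hW.lt_cb
  refine ⟨1, one_pos, ?_⟩
  intro δ _ _ vf lam aE cE bE hmin hEL hlam hzero ρ hρ hρ' θ₁ θ₂ _ _ _ _
  have hρa : ρ < (c - a) / 2 := by linarith [min_le_left (c - a) (b - c)]
  have hρb : ρ < (b - c) / 2 := by linarith [min_le_right (c - a) (b - c)]
  obtain ⟨r₁, hr₁, κ₁, hκ₁, k₁, hk₁, key₁⟩ := hW.key_b hρ
  obtain ⟨r₂, hr₂, κ₂, hκ₂, k₂, hk₂, key₂⟩ := hW.reflect.key_b hρ
  obtain ⟨r, hr0, hra, hrb, hrc, hrd⟩ : ∃ r > 0, r ≤ r₁ ∧ r ≤ r₂ ∧ r ≤ (c - a) / 2 ∧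
      r ≤ (b - c) / 2 :=
    ⟨min r₁ (min r₂ (min ((c - a) / 2) ((b - c) / 2))), by
      have : 0 < c - a := by linarith
      have : 0 < b - c := by linarith
      positivity, by simp, by simp, by simp, by simp⟩
  obtain ⟨k₃, hk₃, hloc⟩ := hW.localize hr0
  set κ := min κ₁ κ₂ with hκdef
  have hκ : 0 < κ := lt_min hκ₁ hκ₂
  have hd5 := hη.d₅_pos
  obtain ⟨ν, hν, hνκ⟩ : ∃ ν > 0, 2 * ν ^ 2 + 4 * d₅ * ν < κ := by
    refine ⟨min 1 (κ / 2 / (2 + 4 * d₅)), by positivity, ?_⟩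
    set ν := min 1 (κ / 2 / (2 + 4 * d₅)) with hν
    have h1 : ν ≤ 1 := min_le_left _ _
    have h2 : ν ≤ κ / 2 / (2 + 4 * d₅) := min_le_right _ _
    have h0 : 0 < ν := by positivity
    rw [le_div_iff₀ (by positivity)] at h2
    nlinarith
  have hεlam : Tendsto (fun ε => ε * lam ε) (𝓝[>] (0 : ℝ)) (𝓝 0) := by
    have h1 : Tendsto (fun ε : ℝ => ε) (𝓝[>] (0 : ℝ)) (𝓝 0) := nhdsWithin_le_nhds
    simpa using h1.mul hlam
  have hsmall : ∀ᶠ ε in 𝓝[>] (0 : ℝ), |ε * lam ε| < min k₁ (min k₂ k₃) := by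
    have h1 := hεlam.abs
    rw [abs_zero] at h1
    exact h1.eventually (gt_mem_nhds (by positivity))
  have hlog : 0 < Real.log 2 := Real.log_pos one_lt_two
  refine ⟨min (ν / 2) (Real.log 2), by positivity, ?_⟩
  have hall := hEL.and (hzero.and hsmall)
  obtain ⟨ε₀, hε₀, hsub⟩ := mem_nhdsGT_iff_exists_Ioo_subset.1 hall
  refine ⟨ε₀, hε₀, fun ε hε => ?_⟩
  obtain ⟨hEL, ⟨hz, hz1, hz2, hrange⟩, hsm⟩ := hsub hε
  have hε0 : 0 < ε := hε.1
  have hv : ∀ s ∈ Ioo (-T) T, DifferentiableAt ℝ (vf ε) s := (hmin ε hε0).1.1.1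
  have hηall : ∀ s ∈ Ioo (-T) T, 0 < η s ∧ DifferentiableAt ℝ η s ∧
      |deriv η s| ≤ d₅ * η s / min (T - s) (s + T) := fun s hs =>
    ⟨hη.pos s hs, (hη.smooth.differentiableOn one_ne_zero).differentiableAt
      (isOpen_Ioo.mem_nhds hs), hη.deriv_bound s hs⟩
  have hcn : ∀ k : ℕ, ∀ θ : ℝ, 0 ≤ cnn k * ε ^ θ := by
    intro k θ
    refine mul_nonneg ?_ (Real.rpow_nonneg hε0.le _)
    unfold cnn; split_ifs <;> norm_num
  have hIcc : Icc (-T + cnn n₁ * ε ^ θ₁) (T - cnn n₂ * ε ^ θ₂) ⊆ Icc (-T) T :=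
    Icc_subset_Icc (by linarith [hcn n₁ θ₁]) (by linarith [hcn n₂ θ₂])
  have ha0 := (hz (aE ε)).2 (Or.inl rfl)
  have hc0 := (hz (cE ε)).2 (Or.inr (Or.inl rfl))
  have hb0 := (hz (bE ε)).2 (Or.inr (Or.inr rfl))
  have ha1 : deriv W (aE ε) = -(ε * lam ε) := by linarith
  have hb1 : deriv W (bE ε) = -(ε * lam ε) := by linarith
  obtain ⟨hla, hlb⟩ := hloc (aE ε) (cE ε) (bE ε) hz1 hz2 (by linarith) (by linarith)
    (by rw [ha1, abs_neg]; exact hsm.trans_le ((min_le_right _ _).trans (min_le_right _ _)))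
  have K₁ := key₁ (bE ε) ⟨by linarith [hlb.1], by linarith [hlb.2]⟩
    (by rw [hb1, abs_neg]; exact hsm.trans_le (min_le_left _ _))
  have K₂ := key₂ (-aE ε) ⟨by linarith [hla.2], by linarith [hla.1]⟩
    (by
      rw [deriv_comp_neg, neg_neg, abs_neg, ha1, abs_neg]
      exact hsm.trans_le ((min_le_right _ _).trans (min_le_left _ _)))
  constructor
  · intro J hJ t ht
    obtain ⟨-, -, hJA, -⟩ := hJ
    refine phase_barrier (w := fun s => bE ε - vf ε s) (M := bE ε - c - ρ) hηall hd5 hε0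
      (fun s hs => hIcc (hJA hs).1) (fun s hs => (hv s hs).const_sub _) (by linarith [hlb.1])
      (fun s hs => by have := (hJA hs).2; show bE ε - vf ε s ≤ _; linarith) ?_ hν hνκ
      (by positivity) (min_le_left _ _) (min_le_right _ _) ht
    intro s hs hsI
    have e1 : (fun s => deriv (fun s => bE ε - vf ε s) s * η s)
        = fun s => -(deriv (vf ε) s * η s) := by
      funext x; rw [deriv_const_sub, neg_mul]
    rw [e1, deriv.fun_neg]
    have h1 := K₁ (vf ε s) ⟨(hJA hs).2, (hrange s hsI).2⟩
    have h2 := hEL s hsI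
    have h3 := hη.pos s hsI
    have h4 : κ * (bE ε - vf ε s) ≤ deriv W (bE ε) - deriv W (vf ε s) :=
      (mul_le_mul_of_nonneg_right (min_le_left _ _) (by linarith [(hrange s hsI).2])).trans h1
    have h5 := mul_le_mul_of_nonneg_right h4 h3.le
    rw [hb1] at h5
    show κ * (bE ε - vf ε s) * η s ≤ _
    linarith
  · intro J hJ t ht
    obtain ⟨-, -, hJA, -⟩ := hJ
    refine phase_barrier (w := fun s => vf ε s - aE ε) (M := c - ρ - aE ε) hηall hd5 hε0
      (fun s hs => hIcc (hJA hs).1) (fun s hs => (hv s hs).sub_const _) (by linarith [hla.2])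
      (fun s hs => by have := (hJA hs).2; show vf ε s - aE ε ≤ _; linarith) ?_ hν hνκ
      (by positivity) (min_le_left _ _) (min_le_right _ _) ht
    intro s hs hsI
    have e1 : (fun s => deriv (fun s => vf ε s - aE ε) s * η s)
        = fun s => (deriv (vf ε) s * η s) := by
      funext x; rw [deriv_sub_const]
    rw [e1]
    have h1 := K₂ (-vf ε s) ⟨by linarith [(hJA hs).2], by linarith [(hrange s hsI).1]⟩
    rw [deriv_comp_neg, deriv_comp_neg, neg_neg, neg_neg] at h1
    have h2 := hEL s hsI
    have h3 := hη.pos s hsI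
    have h4 : κ * (vf ε s - aE ε) ≤ deriv W (vf ε s) - deriv W (aE ε) :=
      (mul_le_mul_of_nonneg_right (min_le_right _ _) (by linarith [(hrange s hsI).1])).trans
        (by linarith)
    have h5 := mul_le_mul_of_nonneg_right h4 h3.le
    rw [ha1] at h5
    show κ * (vf ε s - aE ε) * η s ≤ _
    linarith
end
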